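/- arXiv:2206.01511 — 5 statements merged into one kernel-verified Lean document; each statement's English description precedes it below -/
import Mathlib

section
/- If G is a finite 2-connected outerplanar graph with Δ(G) = 3 and girth g(G) ≥ 4, then χ_{vi,1}(G) ≤ 6. -/
open SimpleGraph

variable {V : Type*}

/-- `(v, e)` is an incidence of `G`: `e` is an edge of `G` and `v ∈ e`. -/
def SimpleGraph.IsIncidence (G : SimpleGraph V) (v : V) (e : Sym2 V) : Prop :=
  e ∈ G.edgeSet ∧ v ∈ e

/-- A vi-simultaneous proper `k`-coloring of `G`, given by a coloring `cV` of the vertices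
and a coloring `cI` of the incidences (the value of `cI v e` matters only when `(v, e)` is
an incidence of `G`). -/
structure SimpleGraph.IsViColoring (G : SimpleGraph V) (k : ℕ)
    (cV : V → Fin k) (cI : V → Sym2 V → Fin k) : Prop where
  /-- adjacent vertices receive distinct colors -/
  adj_ne : ∀ ⦃u v⦄, G.Adj u v → cV u ≠ cV v
  /-- a vertex `u` and an incidence `(w, f)` with `u ∈ f` receive distinct colors -/
  vertex_inc_ne : ∀ ⦃u w f⦄, G.IsIncidence w f → u ∈ f → cV u ≠ cI w f
  /-- two distinct incidences `(v, e)` and `(w, f)` receive distinct colors whenever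
  `v = w`, or `e = f`, or the edge `{v, w}` equals `e` or `f` -/
  inc_ne : ∀ ⦃v e w f⦄, G.IsIncidence v e → G.IsIncidence w f → (v, e) ≠ (w, f) →
    (v = w ∨ e = f ∨ s(v, w) = e ∨ s(v, w) = f) → cI v e ≠ cI w f

/-- The set of colors appearing on the second incidences
`I_2(u) = {(v, {u, v}) : v adjacent to u}` of a vertex `u`. -/
def SimpleGraph.secondIncColors (G : SimpleGraph V) {k : ℕ}
    (cI : V → Sym2 V → Fin k) (u : V) : Set (Fin k) :=
  {a | ∃ v, G.Adj u v ∧ cI v s(u, v) = a}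

/-- The vi-simultaneous chromatic number `χ_vi(G)`. -/
noncomputable def SimpleGraph.chiVi (G : SimpleGraph V) : ℕ :=
  sInf {k | ∃ cV cI, G.IsViColoring k cV cI}

/-- `χ_{vi,s}(G)`: the least `k` admitting a vi-simultaneous `(k, s)`-coloring, i.e. a
vi-simultaneous proper `k`-coloring using at most `s` colors on `I_2(v)` for each vertex `v`. -/
noncomputable def SimpleGraph.chiViS (G : SimpleGraph V) (s : ℕ) : ℕ :=
  sInf {k | ∃ cV cI, G.IsViColoring k cV cI ∧
    ∀ u, (G.secondIncColors cI u).ncard ≤ s}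

/-- `G` is outerplanar: there is a linear ordering of the vertices such that no two edges
`{a, b}` and `{c, d}` satisfy `a < c < b < d`. -/
def SimpleGraph.Outerplanar (G : SimpleGraph V) : Prop :=
  ∃ r : LinearOrder V, ∀ a b c d : V, G.Adj a b → G.Adj c d →
    ¬(r.lt a c ∧ r.lt c b ∧ r.lt b d)

/-- The maximum degree `Δ(G)` of a finite graph. -/
noncomputable def SimpleGraph.maxDeg (G : SimpleGraph V) [Fintype V] : ℕ :=
  Finset.univ.sup fun v => (G.neighborSet v).ncard

/-- `G` is 2-connected: it has at least 3 vertices, is connected, and deleting any single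
vertex leaves it connected. -/
def SimpleGraph.TwoConnected (G : SimpleGraph V) [Fintype V] : Prop :=
  3 ≤ Fintype.card V ∧ G.Connected ∧
    ∀ v : V, (((⊤ : G.Subgraph).deleteVerts {v}).coe).Connected

namespace SimpleGraph

/-- A pair of colorings `c`, `d` of the vertices in `S` encoding a vi-simultaneous
`(6, 1)`-coloring of the subgraph induced on `S`: `c` colors the vertices, and `d u` is the
common color of the second incidences of `u`. -/
structure IsPairColoring (G : SimpleGraph V) (S : Finset V) (c d : V → Fin 6) : Prop where
  self_ne : ∀ u ∈ S, c u ≠ d u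
  adj_ne : ∀ u ∈ S, ∀ v ∈ S, G.Adj u v → c u ≠ c v ∧ c u ≠ d v ∧ d u ≠ d v
  common_ne : ∀ u ∈ S, ∀ v ∈ S, ∀ w ∈ S, G.Adj w u → G.Adj w v → u ≠ v → d u ≠ d v

theorem exists_color_avoiding (a b c d e : Fin 6) :
    ∃ x, x ≠ a ∧ x ≠ b ∧ x ≠ c ∧ x ≠ d ∧ x ≠ e := by
  have h : ({a, b, c, d, e} : Finset (Fin 6)).card < (Finset.univ : Finset (Fin 6)).card :=
    lt_of_le_of_lt Finset.card_le_five (by simp)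
  obtain ⟨x, -, hx⟩ := Finset.exists_mem_notMem_of_card_lt_card h
  exact ⟨x, by simpa using hx⟩

theorem exists_other_neighbors {G : SimpleGraph V}
    (hdeg : ∀ v : V, ∀ a b c e, G.Adj v a → G.Adj v b → G.Adj v c → G.Adj v e →
      a = b ∨ a = c ∨ a = e ∨ b = c ∨ b = e ∨ c = e)
    {v x : V} (hx : G.Adj v x) :
    ∃ p q, ∀ y, G.Adj v y → y = x ∨ y = p ∨ y = q := by
  by_cases hp : ∃ p, G.Adj v p ∧ p ≠ x
  · obtain ⟨p, hp, hpx⟩ := hp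
    by_cases hq : ∃ q, G.Adj v q ∧ q ≠ x ∧ q ≠ p
    · obtain ⟨q, hq, hqx, hqp⟩ := hq
      exact ⟨p, q, fun y hy => by grind⟩
    · exact ⟨p, p, by grind⟩
  · exact ⟨x, x, by grind⟩

/-- Recoloring the vertices in `R` extends a coloring of `S \ R` to `S` provided that all
constraints involving a vertex of `R` are satisfied. -/
theorem IsPairColoring.of_sdiff {G : SimpleGraph V} [DecidableEq V] {S R : Finset V}
    {c d c' d' : V → Fin 6} (h : G.IsPairColoring (S \ R) c d)
    (hc : ∀ v ∉ R, c' v = c v) (hd : ∀ v ∉ R, d' v = d v)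
    (hself : ∀ u ∈ R, c' u ≠ d' u)
    (hadj : ∀ u ∈ R, ∀ v ∈ S, G.Adj u v →
      c' u ≠ c' v ∧ c' u ≠ d' v ∧ c' v ≠ d' u ∧ d' u ≠ d' v)
    (hcommon : ∀ u ∈ R, ∀ w ∈ S, ∀ v ∈ S, G.Adj u w → G.Adj w v → u ≠ v → d' u ≠ d' v)
    (hmid : ∀ w ∈ R, ∀ u ∈ S, ∀ v ∈ S, G.Adj w u → G.Adj w v → u ≠ v → d' u ≠ d' v) :
    G.IsPairColoring S c' d' where
  self_ne u hu := by
    by_cases huR : u ∈ R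
    · exact hself u huR
    · rw [hc u huR, hd u huR]
      exact h.self_ne u (by simp [hu, huR])
  adj_ne u hu v hv huv := by
    by_cases huR : u ∈ R
    · obtain ⟨h1, h2, -, h4⟩ := hadj u huR v hv huv
      exact ⟨h1, h2, h4⟩
    by_cases hvR : v ∈ R
    · obtain ⟨h1, -, h3, h4⟩ := hadj v hvR u hu huv.symm
      exact ⟨h1.symm, h3, h4.symm⟩
    rw [hc u huR, hd u huR, hc v hvR, hd v hvR]
    exact h.adj_ne u (by simp [hu, huR]) v (by simp [hv, hvR]) huv
  common_ne u hu v hv w hw hwu hwv huv := by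
    by_cases huR : u ∈ R
    · exact hcommon u huR w hw v hv hwu.symm hwv huv
    by_cases hvR : v ∈ R
    · exact (hcommon v hvR w hw u hu hwv.symm hwu huv.symm).symm
    by_cases hwR : w ∈ R
    · exact hmid w hwR u hu v hv hwu hwv huv
    rw [hd u huR, hd v hvR]
    exact h.common_ne u (by simp [hu, huR]) v (by simp [hv, hvR]) w (by simp [hw, hwR]) hwu hwv huv

theorem IsPairColoring.extend_pendant {G : SimpleGraph V} [DecidableEq V] {S : Finset V}
    {x w p q : V} (hx : ∀ y ∈ S, G.Adj x y → y = w)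
    (hw : G.Adj w x → ∀ y, G.Adj w y → y = x ∨ y = p ∨ y = q)
    {c d : V → Fin 6} (h : G.IsPairColoring (S \ {x}) c d) :
    ∃ c d, G.IsPairColoring S c d := by
  obtain ⟨dx, hdx⟩ := exists_color_avoiding (d w) (d p) (d q) (c w) (c w)
  obtain ⟨cx, hcx⟩ := exists_color_avoiding dx (d w) (c w) (c w) (c w)
  obtain ⟨c', hc'⟩ : ∃ c' : V → Fin 6, c' = fun v => if v = x then cx else c v := ⟨_, rfl⟩
  obtain ⟨d', hd'⟩ : ∃ d' : V → Fin 6, d' = fun v => if v = x then dx else d v := ⟨_, rfl⟩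
  have cx' : c' x = cx := by simp [hc']
  have dx' : d' x = dx := by simp [hd']
  have c_old : ∀ v ∉ ({x} : Finset V), c' v = c v := by
    intro v hv
    rw [Finset.mem_singleton] at hv
    simp [hc', hv]
  have d_old : ∀ v ∉ ({x} : Finset V), d' v = d v := by
    intro v hv
    rw [Finset.mem_singleton] at hv
    simp [hd', hv]
  clear hc' hd'
  have hs : ∀ u v, G.Adj u v → G.Adj v u := fun _ _ h => h.symm
  refine ⟨c', d', h.of_sdiff c_old d_old ?_ ?_ ?_ ?_⟩ <;>
    simp only [Finset.mem_singleton, forall_eq] at c_old d_old ⊢ <;> clear h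
  · grind -lia
  · intro v hv hadj
    have := hadj.ne
    grind -lia
  · grind -lia
  · grind -lia

theorem IsPairColoring.extend_path_three {G : SimpleGraph V} [DecidableEq V] {S : Finset V}
    {a x y z e p q r s : V} (hax : a ≠ x) (hay : a ≠ y) (haz : a ≠ z) (hex : e ≠ x) (hey : e ≠ y)
    (hez : e ≠ z) (hxy : x ≠ y) (hxz : x ≠ z) (hyz : y ≠ z)
    (hx : ∀ v ∈ S, G.Adj x v → v = a ∨ v = y) (hy : ∀ v ∈ S, G.Adj y v → v = x ∨ v = z)
    (hz : ∀ v ∈ S, G.Adj z v → v = y ∨ v = e)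
    (ha : ∀ v, G.Adj a v → v = x ∨ v = p ∨ v = q) (he : ∀ v, G.Adj e v → v = z ∨ v = r ∨ v = s)
    {c d : V → Fin 6} (h : G.IsPairColoring (S \ {x, y, z}) c d) :
    ∃ c d, G.IsPairColoring S c d := by
  obtain ⟨dx, hdx⟩ := exists_color_avoiding (d a) (d p) (d q) (c a) (c a)
  obtain ⟨dz, hdz⟩ := exists_color_avoiding (d e) (d r) (d s) (c e) dx
  obtain ⟨dy, hdy⟩ := exists_color_avoiding (d a) (d e) dx dz dz
  obtain ⟨cx, hcx⟩ := exists_color_avoiding (d a) dx dy (c a) (c a)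
  obtain ⟨cz, hcz⟩ := exists_color_avoiding (d e) dz dy (c e) (c e)
  obtain ⟨cy, hcy⟩ := exists_color_avoiding dx dy dz cx cz
  obtain ⟨c', hc'⟩ : ∃ c' : V → Fin 6, c' = fun v =>
      if v = x then cx else if v = y then cy else if v = z then cz else c v := ⟨_, rfl⟩
  obtain ⟨d', hd'⟩ : ∃ d' : V → Fin 6, d' = fun v =>
      if v = x then dx else if v = y then dy else if v = z then dz else d v := ⟨_, rfl⟩
  have cx' : c' x = cx := by simp [hc']
  have cy' : c' y = cy := by simp [hc', hxy.symm]
  have cz' : c' z = cz := by simp [hc', hxz.symm, hyz.symm]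
  have dx' : d' x = dx := by simp [hd']
  have dy' : d' y = dy := by simp [hd', hxy.symm]
  have dz' : d' z = dz := by simp [hd', hxz.symm, hyz.symm]
  have c_old : ∀ v ∉ ({x, y, z} : Finset V), c' v = c v := by
    intro v hv
    simp only [Finset.mem_insert, Finset.mem_singleton, not_or] at hv
    simp [hc', hv]
  have d_old : ∀ v ∉ ({x, y, z} : Finset V), d' v = d v := by
    intro v hv
    simp only [Finset.mem_insert, Finset.mem_singleton, not_or] at hv
    simp [hd', hv]
  clear hc' hd'
  have hs : ∀ u v, G.Adj u v → G.Adj v u := fun _ _ h => h.symm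
  refine ⟨c', d', h.of_sdiff c_old d_old ?_ ?_ ?_ ?_⟩ <;>
    simp only [Finset.mem_insert, Finset.mem_singleton, forall_eq_or_imp, forall_eq, not_or]
      at c_old d_old ⊢ <;>
    clear h
  · grind -lia
  · refine ⟨fun v hv hadj => ?_, fun v hv hadj => ?_, fun v hv hadj => ?_⟩
    · have := hx v hv hadj
      clear hx hy hz ha he hs
      grind -lia
    · have := hy v hv hadj
      clear hx hy hz ha he hs
      grind -lia
    · have := hz v hv hadj
      clear hx hy hz ha he hs
      grind -lia
  · grind -lia
  · grind -lia

theorem IsPairColoring.extend_square {G : SimpleGraph V} [DecidableEq V] {S : Finset V}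
    {a x y b p q : V} (hax : a ≠ x) (hay : a ≠ y) (hbx : b ≠ x) (hby : b ≠ y) (hxy : x ≠ y)
    (hx : ∀ v ∈ S, G.Adj x v → v = a ∨ v = y) (hy : ∀ v ∈ S, G.Adj y v → v = x ∨ v = b)
    (ha : ∀ v, G.Adj a v → v = x ∨ v = b ∨ v = p) (hb : ∀ v, G.Adj b v → v = y ∨ v = a ∨ v = q)
    {c d : V → Fin 6} (h : G.IsPairColoring (S \ {x, y}) c d) :
    ∃ c d, G.IsPairColoring S c d := by
  obtain ⟨dx, hdx⟩ := exists_color_avoiding (d a) (d b) (d p) (c a) (c a)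
  obtain ⟨dy, hdy⟩ := exists_color_avoiding (d a) (d b) (d q) (c b) dx
  obtain ⟨cx, hcx⟩ := exists_color_avoiding (d a) dx dy (c a) (c a)
  obtain ⟨cy, hcy⟩ := exists_color_avoiding (d b) dx dy (c b) cx
  obtain ⟨c', hc'⟩ : ∃ c' : V → Fin 6, c' = fun v =>
      if v = x then cx else if v = y then cy else c v := ⟨_, rfl⟩
  obtain ⟨d', hd'⟩ : ∃ d' : V → Fin 6, d' = fun v =>
      if v = x then dx else if v = y then dy else d v := ⟨_, rfl⟩
  have cx' : c' x = cx := by simp [hc']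
  have cy' : c' y = cy := by simp [hc', hxy.symm]
  have dx' : d' x = dx := by simp [hd']
  have dy' : d' y = dy := by simp [hd', hxy.symm]
  have c_old : ∀ v ∉ ({x, y} : Finset V), c' v = c v := by
    intro v hv
    simp only [Finset.mem_insert, Finset.mem_singleton, not_or] at hv
    simp [hc', hv]
  have d_old : ∀ v ∉ ({x, y} : Finset V), d' v = d v := by
    intro v hv
    simp only [Finset.mem_insert, Finset.mem_singleton, not_or] at hv
    simp [hd', hv]
  clear hc' hd'
  have hs : ∀ u v, G.Adj u v → G.Adj v u := fun _ _ h => h.symm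
  refine ⟨c', d', h.of_sdiff c_old d_old ?_ ?_ ?_ ?_⟩ <;>
    simp only [Finset.mem_insert, Finset.mem_singleton, forall_eq_or_imp, forall_eq, not_or]
      at c_old d_old ⊢ <;>
    clear h
  · grind -lia
  · grind -lia
  · grind -lia
  · grind -lia

/-- An edge with some vertex of `S` strictly between its endpoints, chosen to enclose as few
such vertices as possible. If no such edge exists then all edges join consecutive vertices. -/
theorem exists_minimal_chord {G : SimpleGraph V} [LinearOrder V] {S : Finset V}
    (hS : S.Nonempty) (hmin : ∀ x ∈ S, ∀ w, ∃ y ∈ S, G.Adj x y ∧ y ≠ w) :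
    ∃ a ∈ S, ∃ b ∈ S, G.Adj a b ∧ (∃ t ∈ S, a < t ∧ t < b) ∧
      ∀ u ∈ S, ∀ v ∈ S, a ≤ u → v ≤ b → (a < u ∨ v < b) → G.Adj u v →
        ∀ t ∈ S, u < t → ¬ t < v := by
  classical
  let T : V × V → Finset V := fun e => S.filter fun t => e.1 < t ∧ t < e.2
  let E := (S ×ˢ S).filter fun e => G.Adj e.1 e.2 ∧ (T e).Nonempty
  have hE : E.Nonempty := by
    obtain ⟨y, hy, hxy, -⟩ := hmin (S.min' hS) (S.min'_mem hS) (S.min' hS)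
    obtain ⟨z, hz, hxz, hzy⟩ := hmin (S.min' hS) (S.min'_mem hS) y
    have h1 := lt_of_le_of_ne (S.min'_le y hy) hxy.ne
    have h2 := lt_of_le_of_ne (S.min'_le z hz) hxz.ne
    rcases lt_or_gt_of_ne hzy with h | h
    · exact ⟨(S.min' hS, y), by
        simp only [E, T, Finset.mem_filter, Finset.mem_product, Finset.Nonempty]
        exact ⟨⟨S.min'_mem hS, hy⟩, hxy, z, hz, h2, h⟩⟩
    · exact ⟨(S.min' hS, z), by
        simp only [E, T, Finset.mem_filter, Finset.mem_product, Finset.Nonempty]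
        exact ⟨⟨S.min'_mem hS, hz⟩, hxz, y, hy, h1, h⟩⟩
  obtain ⟨⟨a, b⟩, hab, hmin'⟩ := Finset.exists_min_image E (fun e => (T e).card) hE
  simp only [E, Finset.mem_filter, Finset.mem_product] at hab hmin'
  obtain ⟨⟨ha, hb⟩, hadj, t, ht⟩ := hab
  simp only [T, Finset.mem_filter] at ht
  refine ⟨a, ha, b, hb, hadj, ⟨t, ht⟩, fun u hu v hv hau hvb hlt huv s hs hus hsv => ?_⟩
  have hle := hmin' (u, v) ⟨⟨hu, hv⟩, huv, s, by simp [T, hs, hus, hsv]⟩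
  refine absurd hle (not_le.2 (Finset.card_lt_card ?_))
  rw [Finset.ssubset_iff_of_subset (by
    intro r hr
    simp only [T, Finset.mem_filter] at hr ⊢
    exact ⟨hr.1, hau.trans_lt hr.2.1, hr.2.2.trans_le hvb⟩)]
  rcases hlt with h | h
  · exact ⟨u, by simp [T, hu, h, (hus.trans hsv).trans_le hvb], by simp [T]⟩
  · exact ⟨v, by simp [T, hv, h, hau.trans_lt (hus.trans hsv)], by simp [T]⟩

theorem exists_isPairColoring {G : SimpleGraph V} [LinearOrder V]
    (hcross : ∀ a b c d : V, G.Adj a b → G.Adj c d → ¬(a < c ∧ c < b ∧ b < d))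
    (hdeg : ∀ v : V, ∀ a b c e, G.Adj v a → G.Adj v b → G.Adj v c → G.Adj v e →
      a = b ∨ a = c ∨ a = e ∨ b = c ∨ b = e ∨ c = e)
    (htri : ∀ a b c : V, G.Adj a b → G.Adj b c → ¬ G.Adj a c) (S : Finset V) :
    ∃ c d, G.IsPairColoring S c d := by
  induction S using Finset.strongInduction with
  | H S ih =>
  by_cases hmin : ∀ x ∈ S, ∀ w, ∃ y ∈ S, G.Adj x y ∧ y ≠ w
  swap
  · push Not at hmin
    obtain ⟨x, hx, w, hw⟩ := hmin
    obtain ⟨c, d, h⟩ := ih (S \ {x}) (Finset.sdiff_ssubset (by simpa using hx) (by simp))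
    by_cases hwx : G.Adj w x
    · obtain ⟨p, q, hpq⟩ := exists_other_neighbors hdeg hwx
      exact h.extend_pendant hw fun _ => hpq
    · exact h.extend_pendant (p := x) (q := x) hw fun h => absurd h hwx
  rcases S.eq_empty_or_nonempty with rfl | hS
  · exact ⟨fun _ => 0, fun _ => 0, by simp, by simp, by simp⟩
  obtain ⟨a, ha, b, hb, hab, ⟨t, ht, hat, htb⟩, hcons⟩ := exists_minimal_chord hS hmin
  have hnbr : ∀ x ∈ S, a < x → x < b → ∃ l ∈ S, ∃ u ∈ S, a ≤ l ∧ u ≤ b ∧ l < x ∧ x < u ∧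
      G.Adj l x ∧ G.Adj x u ∧ (∀ t ∈ S, l < t → ¬ t < x) ∧ (∀ t ∈ S, x < t → ¬ t < u) ∧
      ∀ v ∈ S, G.Adj x v → v = l ∨ v = u := by
    intro x hx hax hxb
    have hrange : ∀ y, G.Adj x y → a ≤ y ∧ y ≤ b := fun y hy =>
      ⟨not_lt.1 fun h => hcross y x a b hy.symm hab ⟨h, hax, hxb⟩,
        not_lt.1 fun h => hcross a b x y hab hy ⟨hax, hxb, h⟩⟩
    have hup : ∀ y ∈ S, G.Adj x y → ∀ t ∈ S, x < t → ¬ t < y := fun y hy h =>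
      hcons x hx y hy hax.le (hrange y h).2 (Or.inl hax) h
    have hdown : ∀ y ∈ S, G.Adj x y → ∀ t ∈ S, y < t → ¬ t < x := fun y hy h =>
      hcons y hy x hx (hrange y h).1 hxb.le (Or.inr hxb) h.symm
    have key : ∀ y ∈ S, ∀ z ∈ S, y < x → x < z → G.Adj x y → G.Adj x z →
        ∃ l ∈ S, ∃ u ∈ S, a ≤ l ∧ u ≤ b ∧ l < x ∧ x < u ∧
        G.Adj l x ∧ G.Adj x u ∧ (∀ t ∈ S, l < t → ¬ t < x) ∧ (∀ t ∈ S, x < t → ¬ t < u) ∧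
        ∀ v ∈ S, G.Adj x v → v = l ∨ v = u := by
      intro y hy z hz hyx hxz hxy hxz'
      refine ⟨y, hy, z, hz, (hrange y hxy).1, (hrange z hxz').2, hyx, hxz, hxy.symm, hxz',
        hdown y hy hxy, hup z hz hxz', fun v hv hxv => ?_⟩
      rcases lt_or_gt_of_ne hxv.ne with h | h
      · exact Or.inr (le_antisymm (not_lt.1 (hup v hv hxv z hz hxz))
          (not_lt.1 (hup z hz hxz' v hv h)))
      · exact Or.inl (le_antisymm (not_lt.1 fun h' => hdown y hy hxy v hv h' h)
          (not_lt.1 fun h' => hdown v hv hxv y hy h' hyx))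
    obtain ⟨y, hy, hxy, -⟩ := hmin x hx x
    obtain ⟨z, hz, hxz, hzy⟩ := hmin x hx y
    rcases lt_or_gt_of_ne hxy.ne with h1 | h1 <;> rcases lt_or_gt_of_ne hxz.ne with h2 | h2
    · exact absurd (le_antisymm (not_lt.1 (hup z hz hxz y hy h1) )
        (not_lt.1 (hup y hy hxy z hz h2))) hzy
    · exact key z hz y hy h2 h1 hxz hxy
    · exact key y hy z hz h1 h2 hxy hxz
    · exact absurd (le_antisymm (not_lt.1 fun h => hdown y hy hxy z hz h h2)
        (not_lt.1 fun h => hdown z hz hxz y hy h h1)) hzy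
  have hT : (S.filter fun s => a < s ∧ s < b).Nonempty := ⟨t, by simp [ht, hat, htb]⟩
  obtain ⟨x, hxT, hxmin⟩ := Finset.exists_min_image _ id hT
  simp only [Finset.mem_filter, id] at hxT hxmin
  obtain ⟨hx, hax, hxb⟩ := hxT
  obtain ⟨l, hl, y, hy, hal, hyb, hlx, hxy, hladj, hxyadj, -, -, hNx⟩ := hnbr x hx hax hxb
  obtain rfl : a = l := by
    by_contra hne
    exact (hxmin l ⟨hl, lt_of_le_of_ne hal hne, hlx.trans hxb⟩).not_gt hlx
  have hyb : y < b := lt_of_le_of_ne hyb fun h => htri a x y hladj hxyadj (h ▸ hab)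
  obtain ⟨x', hx', z, hz, -, hzb, hx'y, hyz, -, hyzadj, -, -, hNy⟩ :=
    hnbr y hy (hax.trans hxy) hyb
  obtain rfl : x = x' := (hNy x hx hxyadj.symm).resolve_right (hxy.trans hyz).ne
  rcases hzb.eq_or_lt with rfl | hzb
  · obtain ⟨c, d, h⟩ := ih (S \ {x, y}) (Finset.sdiff_ssubset
      (by simp [Finset.insert_subset_iff, hx, hy]) (by simp))
    have hpa : ∃ p, ∀ v, G.Adj a v → v = x ∨ v = z ∨ v = p := by
      obtain ⟨p, q, hpq⟩ := exists_other_neighbors hdeg hladj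
      rcases hpq z hab with rfl | rfl | rfl
      · exact absurd rfl hxb.ne
      · exact ⟨q, hpq⟩
      · exact ⟨p, by grind⟩
    have hqb : ∃ q, ∀ v, G.Adj z v → v = y ∨ v = a ∨ v = q := by
      obtain ⟨p, q, hpq⟩ := exists_other_neighbors hdeg hyzadj.symm
      rcases hpq a hab.symm with rfl | rfl | rfl
      · exact absurd rfl (hax.trans hxy).ne
      · exact ⟨q, hpq⟩
      · exact ⟨p, by grind⟩
    obtain ⟨p, hp⟩ := hpa
    obtain ⟨q, hq⟩ := hqb
    exact h.extend_square hax.ne (hax.trans hxy).ne hxb.ne' hyz.ne' hxy.ne hNx hNy hp hq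
  · obtain ⟨y', hy', e, he, -, -, -, hze, -, hzeadj, -, -, hNz⟩ :=
      hnbr z hz (hax.trans (hxy.trans hyz)) hzb
    obtain rfl : y = y' := (hNz y hy hyzadj.symm).resolve_right (hyz.trans hze).ne
    obtain ⟨c, d, h⟩ := ih (S \ {x, y, z}) (Finset.sdiff_ssubset
      (by simp [Finset.insert_subset_iff, hx, hy, hz]) (by simp))
    obtain ⟨p, q, hpq⟩ := exists_other_neighbors hdeg hladj
    obtain ⟨r, s, hrs⟩ := exists_other_neighbors hdeg hzeadj.symm
    exact h.extend_path_three hax.ne (hax.trans hxy).ne (hax.trans (hxy.trans hyz)).ne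
      (hxy.trans (hyz.trans hze)).ne' (hyz.trans hze).ne' hze.ne' hxy.ne (hxy.trans hyz).ne
      hyz.ne hNx hNy hNz hpq hrs

/-- The incidence coloring giving `(v, {u, v})` the color `d u`. -/
noncomputable def incColoringOfSecond {k : ℕ} (d : V → Fin k) (v : V) (e : Sym2 V) : Fin k :=
  open Classical in if h : v ∈ e then d (Sym2.Mem.other h) else d v

theorem incColoringOfSecond_mk {k : ℕ} (d : V → Fin k) (u v : V) :
    incColoringOfSecond d v s(u, v) = d u := by
  have h : v ∈ s(u, v) := by simp
  have h' := Sym2.other_spec h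
  replace h' := Sym2.congr_right.1 (h'.trans Sym2.eq_swap)
  rw [incColoringOfSecond, dif_pos h, h']

theorem IsIncidence.exists_eq {G : SimpleGraph V} {v : V} {e : Sym2 V} (h : G.IsIncidence v e) :
    ∃ u, G.Adj u v ∧ e = s(u, v) := by
  obtain ⟨he, u, rfl⟩ := h
  exact ⟨u, G.adj_symm he, Sym2.eq_swap⟩

theorem IsPairColoring.isViColoring [Fintype V] {G : SimpleGraph V} {c d : V → Fin 6}
    (h : G.IsPairColoring Finset.univ c d) : G.IsViColoring 6 c (incColoringOfSecond d) where
  adj_ne u v huv := (h.adj_ne u (by simp) v (by simp) huv).1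
  vertex_inc_ne u w f hf hu := by
    obtain ⟨x, hx, rfl⟩ := hf.exists_eq
    rw [incColoringOfSecond_mk]
    rcases Sym2.mem_iff.1 hu with rfl | rfl
    · exact h.self_ne _ (by simp)
    · exact (h.adj_ne _ (by simp) _ (by simp) hx.symm).2.1
  inc_ne v e w f he hf hne hrel := by
    obtain ⟨x, hx, rfl⟩ := he.exists_eq
    obtain ⟨y, hy, rfl⟩ := hf.exists_eq
    have hadj : ∀ u v, G.Adj u v → d u ≠ d v := fun u v huv =>
      (h.adj_ne u (by simp) v (by simp) huv).2.2
    rw [incColoringOfSecond_mk, incColoringOfSecond_mk]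
    by_cases hvw : v = w
    · subst hvw
      exact h.common_ne x (by simp) y (by simp) v (by simp) hx.symm hy.symm fun hxy => hne (by
        rw [hxy])
    · simp only [Sym2.eq_iff] at hrel
      have hsym := fun u v (h : G.Adj u v) => h.symm
      grind

theorem secondIncColors_incColoringOfSecond_ncard_le {G : SimpleGraph V} (d : V → Fin 6) (u : V) :
    (G.secondIncColors (incColoringOfSecond d) u).ncard ≤ 1 := by
  rw [Set.ncard_le_one_iff]
  rintro a b ⟨v, -, rfl⟩ ⟨w, -, rfl⟩
  rw [incColoringOfSecond_mk, incColoringOfSecond_mk]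

theorem eq_of_four_neighbors_of_maxDeg_le [Fintype V] {G : SimpleGraph V} (hΔ : G.maxDeg ≤ 3)
    (v a b c e : V) (ha : G.Adj v a) (hb : G.Adj v b) (hc : G.Adj v c) (he : G.Adj v e) :
    a = b ∨ a = c ∨ a = e ∨ b = c ∨ b = e ∨ c = e := by
  classical
  by_contra! hne
  obtain ⟨h1, h2, h3, h4, h5, h6⟩ := hne
  have hv : (G.neighborSet v).ncard ≤ 3 :=
    (Finset.le_sup (f := fun v => (G.neighborSet v).ncard) (Finset.mem_univ v)).trans hΔ
  have hsub : ((({a, b, c, e} : Finset V) : Set V)) ⊆ G.neighborSet v := by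
    intro x hx
    simp only [Finset.coe_insert, Finset.coe_singleton, Set.mem_insert_iff,
      Set.mem_singleton_iff] at hx
    rcases hx with rfl | rfl | rfl | rfl <;> assumption
  have hcard := Set.ncard_le_ncard hsub (Set.toFinite _)
  rw [Set.ncard_coe_finset] at hcard
  have : ({a, b, c, e} : Finset V).card = 4 := by
    simp [h1, h2, h3, h4, h5, h6]
  omega

theorem not_adj_of_four_le_egirth {G : SimpleGraph V} (hg : 4 ≤ G.egirth) (a b c : V)
    (hab : G.Adj a b) (hbc : G.Adj b c) : ¬ G.Adj a c := by
  classical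
  intro hac
  obtain ⟨u, w, hw, hlen⟩ := is3Clique_iff_exists_cycle_length_three.1
    ⟨{a, b, c}, is3Clique_triple_iff.2 ⟨hab, hac, hbc⟩⟩
  have h := le_egirth.1 hg u w hw
  rw [hlen] at h
  exact absurd h (by decide)

end SimpleGraph

/-- If `G` is a finite 2-connected outerplanar graph with `Δ(G) = 3` and girth `g(G) ≥ 4`,
then `χ_{vi,1}(G) ≤ 6`. -/
theorem chiViS_one_le_six [Fintype V] (G : SimpleGraph V) (hG : G.Outerplanar)
    (h2 : G.TwoConnected) (hΔ : G.maxDeg = 3) (hg : 4 ≤ G.egirth) :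
    G.chiViS 1 ≤ 6 := by
  obtain ⟨r, hr⟩ := hG
  let _ : LinearOrder V := r
  obtain ⟨c, d, h⟩ := exists_isPairColoring hr (eq_of_four_neighbors_of_maxDeg_le hΔ.le)
    (not_adj_of_four_le_egirth hg) Finset.univ
  exact Nat.sInf_le ⟨c, incColoringOfSecond d, h.isViColoring,
    secondIncColors_incColoringOfSecond_ncard_le d⟩
end

section
/- For every finite triangle-free outerplanar graph G, χ_{vi,1}(G) ≤ Δ(G) + 3. -/
open SimpleGraph

variable {V : Type*}

namespace ViColoring

/-- The vertex colors `a` and the colors `b` of second incidences encode a vi-simultaneous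
coloring with at most one color on each `I_2(v)`: the incidence `(u, {u, v})` has color `b v`. -/
structure Good {C : Type*} (G : SimpleGraph V) (a b : V → C) : Prop where
  self : ∀ u, a u ≠ b u
  adj : ∀ ⦃u v⦄, G.Adj u v → a u ≠ a v ∧ a u ≠ b v ∧ a v ≠ b u ∧ b u ≠ b v
  nbr : ∀ ⦃m u v⦄, G.Adj m u → G.Adj m v → u ≠ v → b u ≠ b v

/-- The graph obtained from `G` by isolating the vertices of `S`. -/
def isolate (G : SimpleGraph V) (S : Set V) : SimpleGraph V where
  Adj u v := G.Adj u v ∧ u ∉ S ∧ v ∉ S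
  symm := ⟨fun _ _ h => ⟨h.1.symm, h.2.2, h.2.1⟩⟩
  loopless := ⟨fun _ h => h.1.ne rfl⟩

theorem isolate_lt {G : SimpleGraph V} {S : Set V} {u v : V} (h : G.Adj u v) (hu : u ∈ S) :
    isolate G S < G := by
  refine lt_of_le_of_ne (fun _ _ h => h.1) fun he => ?_
  rw [← he] at h
  exact h.2.1 hu

theorem exists_not_mem {k : ℕ} (F : Finset (Fin k)) (h : F.card < k) : ∃ c, c ∉ F := by
  by_contra! hc
  have := Finset.card_le_card (fun x _ => hc x : (Finset.univ : Finset (Fin k)) ⊆ F)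
  simp at this
  omega

/-- A color outside a set `F` that differs from the `b`-colors of all neighbors of `u` other
than `x`. -/
theorem exists_fresh [Finite V] {k : ℕ} {G : SimpleGraph V} {u x : V} (hux : G.Adj u x)
    (b : V → Fin k) (F : Finset (Fin k))
    (h : (G.neighborSet u).ncard + F.card ≤ k) :
    ∃ c, c ∉ F ∧ ∀ w, G.Adj u w → w ≠ x → c ≠ b w := by
  classical
  have := Fintype.ofFinite V
  have hx : x ∈ (G.neighborSet u).toFinset := by simpa using hux
  have h1 := Finset.card_erase_add_one hx
  have h2 : ((((G.neighborSet u).toFinset.erase x).image b) ∪ F).card < k := by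
    have := Finset.card_union_le (((G.neighborSet u).toFinset.erase x).image b) F
    have := Finset.card_image_le (s := (G.neighborSet u).toFinset.erase x) (f := b)
    rw [Set.ncard_eq_toFinset_card'] at h
    omega
  obtain ⟨c, hc⟩ := exists_not_mem _ h2
  simp only [Finset.mem_union, Finset.mem_image, Finset.mem_erase, Set.mem_toFinset,
    mem_neighborSet, not_or, not_exists, not_and] at hc
  exact ⟨c, hc.2, fun w hw hwx he => hc.1 w ⟨hwx, hw⟩ he.symm⟩

theorem exists_ne_five {k : ℕ} (hk : 6 ≤ k) (c₁ c₂ c₃ c₄ c₅ : Fin k) :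
    ∃ c, c ≠ c₁ ∧ c ≠ c₂ ∧ c ≠ c₃ ∧ c ≠ c₄ ∧ c ≠ c₅ := by
  obtain ⟨c, hc⟩ := exists_not_mem {c₁, c₂, c₃, c₄, c₅} (Finset.card_le_five.trans_lt hk)
  exact ⟨c, by simpa using hc⟩

theorem exists_ne_three {k : ℕ} (hk : 4 ≤ k) (c₁ c₂ c₃ : Fin k) :
    ∃ c, c ≠ c₁ ∧ c ≠ c₂ ∧ c ≠ c₃ := by
  obtain ⟨c, hc⟩ := exists_not_mem {c₁, c₂, c₃} (Finset.card_le_three.trans_lt hk)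
  exact ⟨c, by simpa using hc⟩

theorem extend_leaf [Finite V] {k : ℕ} {G : SimpleGraph V} (hk : 4 ≤ k)
    (hdeg : ∀ v, (G.neighborSet v).ncard + 3 ≤ k) {x u : V} (hx : ∀ v, G.Adj x v ↔ v = u)
    {a b : V → Fin k} (h : Good (isolate G {x}) a b) :
    ∃ a b : V → Fin k, Good G a b := by
  classical
  have hxu : G.Adj x u := (hx u).2 rfl
  have hne := hxu.ne
  have hsymm : ∀ v, G.Adj v x ↔ v = u := fun v => (G.adj_comm v x).trans (hx v)
  obtain ⟨bx, hbx, hbx'⟩ := exists_fresh hxu.symm b {b u, a u}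
    (by have := Finset.card_le_two (a := b u) (b := a u); have := hdeg u; omega)
  obtain ⟨ax, hax⟩ := exists_ne_three hk (a u) (b u) bx
  simp only [Finset.mem_insert, Finset.mem_singleton, not_or] at hbx
  obtain ⟨h0, h1, h2⟩ := h
  simp only [isolate, Set.mem_singleton_iff] at h1 h2
  refine ⟨fun v => if v = x then ax else a v, fun v => if v = x then bx else b v, ?_, ?_, ?_⟩
  · intro p
    grind
  · intro p q hpq
    by_cases hp : p = x <;> by_cases hq : q = x <;> grind
  · intro m p q hp hq hpq
    by_cases hm : m = x <;> by_cases hp : p = x <;> by_cases hq : q = x <;> grind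

theorem extend_path [Finite V] {k : ℕ} {G : SimpleGraph V} (hk : 6 ≤ k)
    (hdeg : ∀ v, (G.neighborSet v).ncard + 3 ≤ k) {u x y z w : V}
    (hx : ∀ v, G.Adj x v ↔ v = u ∨ v = y) (hy : ∀ v, G.Adj y v ↔ v = x ∨ v = z)
    (hz : ∀ v, G.Adj z v ↔ v = y ∨ v = w) (hxz : x ≠ z) (huy : u ≠ y) (hwy : w ≠ y)
    (huz : u ≠ z) (hwx : w ≠ x)
    {a b : V → Fin k} (h : Good (isolate G {y, z}) a b) :
    ∃ a b : V → Fin k, Good G a b := by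
  classical
  have hxu : G.Adj x u := (hx u).2 (.inl rfl)
  have hzw : G.Adj z w := (hz w).2 (.inr rfl)
  have hxy : G.Adj x y := (hx y).2 (.inr rfl)
  have hyz : G.Adj y z := (hy z).2 (.inr rfl)
  have := hxu.ne
  have := hzw.ne
  have := hxy.ne
  have := hyz.ne
  have hx' : ∀ v, G.Adj v x ↔ v = u ∨ v = y := fun v => (G.adj_comm v x).trans (hx v)
  have hy' : ∀ v, G.Adj v y ↔ v = x ∨ v = z := fun v => (G.adj_comm v y).trans (hy v)
  have hz' : ∀ v, G.Adj v z ↔ v = y ∨ v = w := fun v => (G.adj_comm v z).trans (hz v)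
  obtain ⟨bz, hbz, hbz'⟩ := exists_fresh hzw.symm b {b w, a w, b x}
    (by have := Finset.card_le_three (a := b w) (b := a w) (c := b x); have := hdeg w; omega)
  obtain ⟨b_y, hby⟩ := exists_ne_five hk (b u) (b x) bz (b w) (b w)
  obtain ⟨az, haz⟩ := exists_ne_five hk (a w) (b w) bz b_y b_y
  obtain ⟨ax, hax⟩ := exists_ne_five hk (a u) (b u) (b x) b_y b_y
  obtain ⟨ay, hay⟩ := exists_ne_five hk (b x) b_y bz ax az
  simp only [Finset.mem_insert, Finset.mem_singleton, not_or] at hbz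
  obtain ⟨h0, h1, h2⟩ := h
  simp only [isolate, Set.mem_singleton_iff, Set.mem_insert_iff, not_or] at h1 h2
  refine ⟨fun v => if v = x then ax else if v = y then ay else if v = z then az else a v,
    fun v => if v = y then b_y else if v = z then bz else b v, ?_, ?_, ?_⟩
  · intro p
    grind
  · intro p q hpq
    by_cases hp : p = x
    · subst hp; grind
    by_cases hp : p = y
    · subst hp; grind
    by_cases hp : p = z
    · subst hp; grind
    by_cases hq : q = x
    · subst hq; grind
    by_cases hq : q = y
    · subst hq; grind
    by_cases hq : q = z
    · subst hq; grind
    grind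
  · intro m p q hp hq hpq
    by_cases hm : m = x
    · subst hm; grind
    by_cases hm : m = y
    · subst hm; grind
    by_cases hm : m = z
    · subst hm; grind
    by_cases hp : p = y
    · subst hp; grind
    by_cases hq : q = y
    · subst hq; grind
    by_cases hp : p = z
    · subst hp; grind
    by_cases hq : q = z
    · subst hq; grind
    grind

theorem extend_square [Finite V] {k : ℕ} {G : SimpleGraph V} (hk : 6 ≤ k)
    (hdeg : ∀ v, (G.neighborSet v).ncard + 3 ≤ k) {u x y v : V}
    (hx : ∀ w, G.Adj x w ↔ w = u ∨ w = y) (hy : ∀ w, G.Adj y w ↔ w = x ∨ w = v)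
    (huv : G.Adj u v) (huy : u ≠ y) (hvx : v ≠ x)
    {a b : V → Fin k} (h : Good (isolate G {x, y}) a b) :
    ∃ a b : V → Fin k, Good G a b := by
  classical
  have hxu : G.Adj x u := (hx u).2 (.inl rfl)
  have hxy : G.Adj x y := (hx y).2 (.inr rfl)
  have hyv : G.Adj y v := (hy v).2 (.inr rfl)
  have := hxu.ne
  have := hxy.ne
  have := hyv.ne
  have := huv.ne
  have := huv.symm
  have hx' : ∀ w, G.Adj w x ↔ w = u ∨ w = y := fun v => (G.adj_comm v x).trans (hx v)
  have hy' : ∀ w, G.Adj w y ↔ w = x ∨ w = v := fun v => (G.adj_comm v y).trans (hy v)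
  obtain ⟨bx, hbx, hbx'⟩ := exists_fresh hxu.symm b {b u, a u}
    (by have := Finset.card_le_two (a := b u) (b := a u); have := hdeg u; omega)
  obtain ⟨b_y, hby, hby'⟩ := exists_fresh hyv.symm b {b v, a v, bx}
    (by have := Finset.card_le_three (a := b v) (b := a v) (c := bx); have := hdeg v; omega)
  obtain ⟨ax, hax⟩ := exists_ne_five hk (a u) (b u) bx b_y b_y
  obtain ⟨ay, hay⟩ := exists_ne_five hk (a v) (b v) bx b_y ax
  simp only [Finset.mem_insert, Finset.mem_singleton, not_or] at hbx hby
  obtain ⟨h0, h1, h2⟩ := h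
  simp only [isolate, Set.mem_singleton_iff, Set.mem_insert_iff, not_or] at h1 h2
  refine ⟨fun v => if v = x then ax else if v = y then ay else a v,
    fun v => if v = x then bx else if v = y then b_y else b v, ?_, ?_, ?_⟩
  · intro p
    grind
  · intro p q hpq
    by_cases hp : p = x
    · subst hp; grind
    by_cases hp : p = y
    · subst hp; grind
    by_cases hq : q = x
    · subst hq; grind
    by_cases hq : q = y
    · subst hq; grind
    grind
  · intro m p q hp hq hpq
    by_cases hm : m = x
    · subst hm; grind
    by_cases hm : m = y
    · subst hm; grind
    by_cases hp : p = x
    · subst hp; grind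
    by_cases hq : q = x
    · subst hq; grind
    by_cases hp : p = y
    · subst hp; grind
    by_cases hq : q = y
    · subst hq; grind
    grind

/-- Five colors suffice for a cyclic sequence of any length `n ≥ 4`; here the sequence of pairs of
colors is unrolled, and the last three conditions allow it to be repeated. -/
theorem exists_cyclic_pattern (n : ℕ) (hn : 4 ≤ n) : ∃ a b : ℕ → Fin 5,
    (a 0 = 2 ∧ b 0 = 0 ∧ b 1 = 1) ∧ (a n = 2 ∧ b n = 0 ∧ b (n + 1) = 1) ∧
    ∀ i < n, a i ≠ b i ∧ a i ≠ a (i + 1) ∧ a i ≠ b (i + 1) ∧ a (i + 1) ≠ b i ∧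
      b i ≠ b (i + 1) ∧ b i ≠ b (i + 2) := by
  induction n using Nat.strong_induction_on with
  | _ n ih =>
    by_cases h8 : n < 8
    · interval_cases n
      · exact ⟨fun i => [2, 3, 0, 1, 2].getD i 0, fun i => [0, 1, 2, 3, 0, 1].getD i 0, by decide⟩
      · exact ⟨fun i => [2, 3, 4, 0, 1, 2].getD i 0, fun i => [0, 1, 2, 3, 4, 0, 1].getD i 0,
          by decide⟩
      · exact ⟨fun i => [2, 3, 2, 1, 4, 1, 2].getD i 0, fun i => [0, 1, 4, 0, 2, 3, 0, 1].getD i 0,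
          by decide⟩
      · exact ⟨fun i => [2, 3, 4, 3, 4, 0, 1, 2].getD i 0,
          fun i => [0, 1, 2, 0, 1, 2, 3, 0, 1].getD i 0, by decide⟩
    · obtain ⟨m, rfl⟩ : ∃ m, n = m + 4 := ⟨n - 4, by omega⟩
      obtain ⟨a, b, ⟨ha, hb, hb'⟩, ⟨ha₁, hb₁, hb₁'⟩, h⟩ := ih m (by omega) (by omega)
      refine ⟨fun i => if i < 4 then [2, 3, 0, 1].getD i 0 else a (i - 4),
        fun i => if i < 4 then [0, 1, 2, 3].getD i 0 else b (i - 4), by simp, ?_, ?_⟩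
      · have : ¬ m + 4 + 1 < 4 := by omega
        have h2 : m + 4 + 1 - 4 = m + 1 := by omega
        simp [this, h2, ha₁, hb₁, hb₁']
      · intro i hi
        by_cases h4 : i < 4
        · interval_cases i <;> simp [ha, hb, hb']
        · obtain ⟨j, rfl⟩ : ∃ j, i = j + 4 := ⟨i - 4, by omega⟩
          have h1 : j + 4 + 1 - 4 = j + 1 := by omega
          have h2 : j + 4 + 2 - 4 = j + 2 := by omega
          have h3 : ¬ j + 4 + 1 < 4 := by omega
          have h5 : ¬ j + 4 + 2 < 4 := by omega
          simpa [h1, h2, h3, h5] using h j (by omega)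

/-- A graph that contains no triangle and is a disjoint union of cycles and isolated vertices has
a cyclic sequence of vertices, closed under adjacency. -/
theorem exists_cyclic_vertices [Finite V] {G : SimpleGraph V} (hcyc : G.IsCycles)
    (htf : G.CliqueFree 3) {u v : V} (huv : G.Adj u v) :
    ∃ (n : ℕ) (g : ℕ → V), 4 ≤ n ∧ (∀ i j, g i = g j ↔ i % n = j % n) ∧
      (∀ i, G.Adj (g i) (g (i + 1))) ∧
      ∀ i w, G.Adj (g (i + 1)) w → w = g i ∨ w = g (i + 2) := by
  obtain ⟨p, hp, -⟩ := hcyc.exists_cycle_toSubgraph_verts_eq_connectedComponentSupp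
    (c := G.connectedComponentMk u) (v := u) rfl ⟨v, huv⟩
  have h3 := hp.three_le_length
  have hinj : ∀ i j, p.getVert (i % p.length) = p.getVert (j % p.length) ↔
      i % p.length = j % p.length := by
    refine fun i j => ⟨fun h => hp.getVert_injOn' ?_ ?_ h, fun h => by rw [h]⟩
    · have := Nat.mod_lt i (by omega : 0 < p.length)
      simp only [Set.mem_ofPred_eq]
      omega
    · have := Nat.mod_lt j (by omega : 0 < p.length)
      simp only [Set.mem_ofPred_eq]
      omega
  have hadj : ∀ i, G.Adj (p.getVert (i % p.length)) (p.getVert ((i + 1) % p.length)) := by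
    intro i
    have hi := Nat.mod_lt i (by omega : 0 < p.length)
    have h := p.adj_getVert_succ hi
    rw [← Nat.mod_add_mod]
    rcases Nat.lt_or_ge (i % p.length + 1) p.length with hlt | hge
    · rwa [Nat.mod_eq_of_lt hlt]
    · have he : i % p.length + 1 = p.length := by omega
      rw [he, p.getVert_length] at h
      rwa [he, Nat.mod_self, p.getVert_zero]
  refine ⟨p.length, fun i => p.getVert (i % p.length), ?_, hinj, hadj, ?_⟩
  · by_contra hlt
    exact (is3Clique_iff_exists_cycle_length_three.mpr ⟨u, p, hp, by omega⟩).elim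
      fun s hs => htf s hs
  · intro i w hw
    have h2 := hcyc ⟨w, hw⟩
    have hne : p.getVert (i % p.length) ≠ p.getVert ((i + 2) % p.length) := by
      rw [Ne, hinj]
      intro h
      have : p.length ∣ i + 2 - i := (Nat.modEq_iff_dvd' (by omega)).1 h
      have := Nat.le_of_dvd (by omega) this
      omega
    have hsub : {p.getVert (i % p.length), p.getVert ((i + 2) % p.length)} ⊆
        G.neighborSet (p.getVert ((i + 1) % p.length)) := by
      rintro z (rfl | rfl)
      · exact (hadj i).symm
      · exact hadj (i + 1)
    have heq := Set.eq_of_subset_of_ncard_le hsub (by rw [h2, Set.ncard_pair hne])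
    have : w ∈ G.neighborSet (p.getVert ((i + 1) % p.length)) := hw
    rw [← heq] at this
    exact this

theorem extend_cycle {G : SimpleGraph V} {n : ℕ} (hn : 4 ≤ n) {g : ℕ → V}
    (hg : ∀ i j, g i = g j ↔ i % n = j % n)
    (hnbr : ∀ i w, G.Adj (g (i + 1)) w → w = g i ∨ w = g (i + 2))
    {a b : V → Fin 5} (h : Good (isolate G (Set.range g)) a b) :
    ∃ a b : V → Fin 5, Good G a b := by
  classical
  obtain ⟨A, B, ⟨hA, hB, hB'⟩, ⟨hAn, hBn, hBn'⟩, hAB⟩ := exists_cyclic_pattern n hn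
  have hpos : 0 < n := by omega
  have hAmod : ∀ j ≤ n, A (j % n) = A j := by
    intro j hj
    rcases hj.lt_or_eq with hj | rfl
    · rw [Nat.mod_eq_of_lt hj]
    · rw [Nat.mod_self, hA, hAn]
  have hBmod : ∀ j ≤ n + 1, B (j % n) = B j := by
    intro j hj
    rcases Nat.lt_or_ge j n with hj' | hj'
    · rw [Nat.mod_eq_of_lt hj']
    · obtain rfl | rfl : j = n ∨ j = n + 1 := by omega
      · rw [Nat.mod_self, hB, hBn]
      · rw [Nat.add_mod_left, Nat.mod_eq_of_lt (by omega), hB', hBn']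
  have hper : ∀ i, A (i % n) ≠ B (i % n) ∧ A (i % n) ≠ A ((i + 1) % n) ∧
      A (i % n) ≠ B ((i + 1) % n) ∧ A ((i + 1) % n) ≠ B (i % n) ∧
      B (i % n) ≠ B ((i + 1) % n) ∧ B (i % n) ≠ B ((i + 2) % n) := by
    intro i
    have hi := Nat.mod_lt i hpos
    rw [← Nat.mod_add_mod i n 1, ← Nat.mod_add_mod i n 2, hAmod (i % n + 1) hi,
      hBmod (i % n + 1) (by omega), hBmod (i % n + 2) (by omega)]
    exact hAB _ hi
  let A' : V → Fin 5 := fun v => if h : ∃ i, g i = v then A (h.choose % n) else a v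
  let B' : V → Fin 5 := fun v => if h : ∃ i, g i = v then B (h.choose % n) else b v
  have hA' : ∀ i, A' (g i) = A (i % n) := by
    intro i
    have hex : ∃ j, g j = g i := ⟨i, rfl⟩
    simp only [A', dif_pos hex]
    rw [(hg _ _).1 hex.choose_spec]
  have hB' : ∀ i, B' (g i) = B (i % n) := by
    intro i
    have hex : ∃ j, g j = g i := ⟨i, rfl⟩
    simp only [B', dif_pos hex]
    rw [(hg _ _).1 hex.choose_spec]
  have hA'' : ∀ v, v ∉ Set.range g → A' v = a v := fun v hv => dif_neg hv
  have hB'' : ∀ v, v ∉ Set.range g → B' v = b v := fun v hv => dif_neg hv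
  have hsucc : ∀ v ∈ Set.range g, ∃ i, v = g (i + 1) := by
    rintro _ ⟨i, rfl⟩
    refine ⟨i + n - 1, (hg _ _).2 ?_⟩
    rw [show i + n - 1 + 1 = i + n by omega, Nat.add_mod_right]
  have hcl : ∀ u v, G.Adj u v → u ∈ Set.range g → v ∈ Set.range g := by
    intro u v huv hu
    obtain ⟨i, rfl⟩ := hsucc u hu
    rcases hnbr i v huv with rfl | rfl <;> exact ⟨_, rfl⟩
  obtain ⟨h0, h1, h2⟩ := h
  refine ⟨A', B', ?_, ?_, ?_⟩
  · intro v
    by_cases hv : v ∈ Set.range g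
    · obtain ⟨i, rfl⟩ := hv
      rw [hA', hB']
      exact (hper i).1
    · rw [hA'' _ hv, hB'' _ hv]
      exact h0 v
  · intro u v huv
    by_cases hu : u ∈ Set.range g
    · obtain ⟨i, rfl⟩ := hsucc u hu
      rcases hnbr i v huv with rfl | rfl
      · have := hper i
        rw [hA', hB', hA', hB']
        exact ⟨this.2.1.symm, this.2.2.2.1, this.2.2.1, this.2.2.2.2.1.symm⟩
      · have := hper (i + 1)
        rw [hA', hB', hA', hB']
        exact ⟨this.2.1, this.2.2.1, this.2.2.2.1, this.2.2.2.2.1⟩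
    · have hv : v ∉ Set.range g := fun hv => hu (hcl v u huv.symm hv)
      rw [hA'' _ hu, hB'' _ hu, hA'' _ hv, hB'' _ hv]
      exact h1 ⟨huv, hu, hv⟩
  · intro m u v hu hv huv
    by_cases hm : m ∈ Set.range g
    · obtain ⟨i, rfl⟩ := hsucc m hm
      have := (hper i).2.2.2.2.2
      rcases hnbr i u hu with rfl | rfl <;> rcases hnbr i v hv with rfl | rfl
      · exact absurd rfl huv
      · rwa [hB', hB']
      · rw [hB', hB']
        exact this.symm
      · exact absurd rfl huv
    · have hu' : u ∉ Set.range g := fun h => hm (hcl u m hu.symm h)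
      have hv' : v ∉ Set.range g := fun h => hm (hcl v m hv.symm h)
      rw [hB'' _ hu', hB'' _ hv']
      exact h2 ⟨hu, hm, hu'⟩ ⟨hv, hm, hv'⟩ huv

/-- A triangle-free outerplanar graph with an edge in which no vertex has degree one contains
three consecutive vertices of degree two, or a quadrilateral with two adjacent vertices of degree
two. -/
theorem exists_reducible [Finite V] {G : SimpleGraph V} (hG : G.Outerplanar)
    (htf : G.CliqueFree 3) (hmin : ∀ x u, G.Adj x u → ∃ v, G.Adj x v ∧ v ≠ u)
    {u₀ v₀ : V} (h₀ : G.Adj u₀ v₀) :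
    (∃ u x y z w, (∀ v, G.Adj x v ↔ v = u ∨ v = y) ∧ (∀ v, G.Adj y v ↔ v = x ∨ v = z) ∧
      (∀ v, G.Adj z v ↔ v = y ∨ v = w) ∧ x ≠ z ∧ u ≠ y ∧ w ≠ y ∧ u ≠ z ∧ w ≠ x) ∨
    ∃ u x y v, (∀ w, G.Adj x w ↔ w = u ∨ w = y) ∧ (∀ w, G.Adj y w ↔ w = x ∨ w = v) ∧
      G.Adj u v ∧ u ≠ y ∧ v ≠ x := by
  obtain ⟨r, hr⟩ := hG
  have htri : ∀ p q s, G.Adj p q → G.Adj q s → G.Adj p s → False := fun p q s h1 h2 h3 =>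
    htf _ (is3Clique_triple_iff.2 ⟨h1, h3, h2⟩)
  have := Fintype.ofFinite V
  -- among the edges covering a nonisolated vertex, one covering a minimal set of vertices
  obtain ⟨⟨a, b⟩, ⟨hab, x, y₀, hax, hxb, hxy₀⟩, hminab⟩ :
      ∃ e : V × V, (G.Adj e.1 e.2 ∧ ∃ z t, e.1 < z ∧ z < e.2 ∧ G.Adj z t) ∧
        ∀ c d, G.Adj c d → (∃ z t, c < z ∧ z < d ∧ G.Adj z t) →
          ¬ ({z | c < z ∧ z < d} ⊂ {z | e.1 < z ∧ z < e.2}) := by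
    have hne : ∃ e : V × V, G.Adj e.1 e.2 ∧ ∃ z t, e.1 < z ∧ z < e.2 ∧ G.Adj z t := by
      obtain ⟨m, ⟨t, hmt⟩, hm⟩ := (Set.toFinite {x | ∃ t, G.Adj x t}).exists_minimal ⟨u₀, v₀, h₀⟩
      obtain ⟨s, hms, hst⟩ := hmin m t hmt
      have hle : ∀ z, (∃ t, G.Adj z t) → m ≤ z := fun z hz =>
        (le_total m z).elim id fun h => hm hz h
      have h1 := lt_of_le_of_ne (hle t ⟨m, hmt.symm⟩) hmt.ne
      have h2 := lt_of_le_of_ne (hle s ⟨m, hms.symm⟩) hms.ne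
      rcases lt_or_gt_of_ne hst with h | h
      · exact ⟨(m, t), hmt, s, m, h2, h, hms.symm⟩
      · exact ⟨(m, s), hms, t, m, h1, h, hmt.symm⟩
    obtain ⟨e, he, hmine⟩ := WellFounded.has_min
      (InvImage.wf (fun e : V × V => {z | e.1 < z ∧ z < e.2}) wellFounded_lt)
      {e | G.Adj e.1 e.2 ∧ ∃ z t, e.1 < z ∧ z < e.2 ∧ G.Adj z t} hne
    exact ⟨e, he, fun c d hcd hz => hmine (c, d) ⟨hcd, hz⟩⟩
  dsimp only at hab hax hxb hminab
  have hshort : ∀ c d z t, G.Adj c d → a ≤ c → d ≤ b → (a < c ∨ d < b) → c < z → z < d →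
      ¬ G.Adj z t := by
    intro c d z t hcd hac hdb hne hcz hzd hzt
    refine hminab c d hcd ⟨z, t, hcz, hzd, hzt⟩ ⟨fun w hw => ⟨hac.trans_lt hw.1,
      hw.2.trans_le hdb⟩, fun hsub => ?_⟩
    have hcd' := hcz.trans hzd
    rcases hne with h | h
    · exact lt_irrefl c (hsub ⟨h, hcd'.trans_le hdb⟩ : c < c ∧ c < d).1
    · exact lt_irrefl d (hsub ⟨hac.trans_lt hcd', h⟩ : c < d ∧ d < d).2
  have hin : ∀ x y, a < x → x < b → G.Adj x y → a ≤ y ∧ y ≤ b := by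
    intro x y h1 h2 hxy
    refine ⟨le_of_not_gt fun h => ?_, le_of_not_gt fun h => ?_⟩
    · exact hr y x a b hxy.symm hab ⟨h, h1, h2⟩
    · exact hr a b x y hab hxy ⟨h1, h2, h⟩
  -- every vertex covered by the edge that is not isolated has one neighbor on each side
  have hdeg : ∀ x t, a < x → x < b → G.Adj x t →
      ∃ l s, l < x ∧ x < s ∧ a ≤ l ∧ s ≤ b ∧ ∀ v, G.Adj x v ↔ v = l ∨ v = s := by
    intro x t h1 h2 hxt
    have hup : ∀ s s', G.Adj x s → G.Adj x s' → x < s → ¬ s < s' := fun s s' hs hs' h3 h4 =>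
      hshort x s' s x hs' h1.le (hin x s' h1 h2 hs').2 (.inl h1) h3 h4 hs.symm
    have hdown : ∀ s s', G.Adj x s → G.Adj x s' → s < x → ¬ s' < s := fun s s' hs hs' h3 h4 =>
      hshort s' x s x hs'.symm (hin x s' h1 h2 hs').1 h2.le (.inr h2) h4 h3 hs.symm
    obtain ⟨s, hxs, hst⟩ := hmin x t hxt
    have key : ∀ l s, G.Adj x l → G.Adj x s → l < s →
        ∃ l s, l < x ∧ x < s ∧ a ≤ l ∧ s ≤ b ∧ ∀ v, G.Adj x v ↔ v = l ∨ v = s := by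
      intro l s hl hs hls
      have hlx : l < x := lt_of_not_ge fun h => hup l s hl hs (lt_of_le_of_ne h hl.ne) hls
      have hxs : x < s := lt_of_not_ge fun h => hdown s l hs hl (lt_of_le_of_ne h hs.ne') hls
      refine ⟨l, s, hlx, hxs, (hin x l h1 h2 hl).1, (hin x s h1 h2 hs).2,
        fun v => ⟨fun hv => ?_, ?_⟩⟩
      · rcases lt_or_gt_of_ne hv.ne with h | h
        · exact .inr (le_antisymm (le_of_not_gt fun h' => hup s v hs hv hxs h')
            (le_of_not_gt fun h' => hup v s hv hs h h'))
        · exact .inl (le_antisymm (le_of_not_gt fun h' => hdown v l hv hl h h')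
            (le_of_not_gt fun h' => hdown l v hl hv hlx h'))
      · rintro (rfl | rfl) <;> assumption
    rcases lt_or_gt_of_ne hst with h | h
    · exact key s t hxs hxt h
    · exact key t s hxt hxs h
  have hnext : ∀ x y l s l' s', (∀ v, G.Adj x v ↔ v = l ∨ v = s) →
      (∀ v, G.Adj y v ↔ v = l' ∨ v = s') → l < x → y < s' → x < y → G.Adj x y → s = y ∧ l' = x := by
    intro x y l s l' s' hx hy h1 h2 h3 h4
    refine ⟨((hx y).1 h4).elim (fun h => ?_) Eq.symm, ((hy x).1 h4.symm).elim Eq.symm fun h => ?_⟩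
    · exact absurd (h ▸ h1) h3.asymm
    · exact absurd (h ▸ h2) h3.asymm
  obtain ⟨w, y, hwx, hxy, haw, hyb, hNx⟩ := hdeg x y₀ hax hxb hxy₀
  have hAxw : G.Adj x w := (hNx w).2 (.inl rfl)
  have hAxy : G.Adj x y := (hNx y).2 (.inr rfl)
  rcases hyb.lt_or_eq with hyb | rfl
  · obtain ⟨l, z, hly, hyz, -, hzb, hNy⟩ := hdeg y x (hax.trans hxy) hyb hAxy.symm
    obtain ⟨-, rfl⟩ := hnext x y w y l z hNx hNy hwx hyz hxy hAxy
    have hAyz : G.Adj y z := (hNy z).2 (.inr rfl)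
    rcases hzb.lt_or_eq with hzb | rfl
    · obtain ⟨l', t, -, hzt, -, -, hNz⟩ := hdeg z y (hax.trans (hxy.trans hyz)) hzb hAyz.symm
      obtain ⟨-, rfl⟩ := hnext y z l z l' t hNy hNz hxy hzt hyz hAyz
      exact .inl ⟨w, l, l', z, t, hNx, hNy, hNz, (hxy.trans hyz).ne, (hwx.trans hxy).ne,
        (hyz.trans hzt).ne', (hwx.trans (hxy.trans hyz)).ne, (hxy.trans (hyz.trans hzt)).ne'⟩
    · rcases haw.lt_or_eq with haw | rfl
      · obtain ⟨q, s, hqw, -, -, -, hNw⟩ := hdeg w l haw (hwx.trans (hxy.trans hyz)) hAxw.symm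
        obtain ⟨rfl, -⟩ := hnext w l q s w y hNw hNx hqw hxy hwx hAxw.symm
        exact .inl ⟨q, w, s, y, z, hNw, hNx, hNy, (hwx.trans hxy).ne, (hqw.trans hwx).ne,
          (hxy.trans hyz).ne', (hqw.trans (hwx.trans hxy)).ne, (hwx.trans (hxy.trans hyz)).ne'⟩
      · exact .inr ⟨a, l, y, z, hNx, hNy, hab, (hwx.trans hxy).ne, (hxy.trans hyz).ne'⟩
  · rcases haw.lt_or_eq with haw | rfl
    · obtain ⟨q, s, hqw, -, haq, -, hNw⟩ := hdeg w x haw (hwx.trans hxb) hAxw.symm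
      obtain ⟨rfl, -⟩ := hnext w x q s w y hNw hNx hqw hxy hwx hAxw.symm
      have hAwq : G.Adj w q := (hNw q).2 (.inl rfl)
      rcases haq.lt_or_eq with haq | rfl
      · obtain ⟨t, q', htq, -, -, -, hNq⟩ :=
          hdeg q w haq (hqw.trans (hwx.trans hxb)) hAwq.symm
        obtain ⟨rfl, -⟩ := hnext q w t q' q s hNq hNw htq hwx hqw hAwq.symm
        exact .inl ⟨t, q, q', s, y, hNq, hNw, hNx, (hqw.trans hwx).ne, (htq.trans hqw).ne,
          (hwx.trans hxy).ne', (htq.trans (hqw.trans hwx)).ne, (hqw.trans (hwx.trans hxy)).ne'⟩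
      · exact .inr ⟨a, w, s, y, hNw, hNx, hab, (hqw.trans hwx).ne, (hwx.trans hxy).ne'⟩
    · exact (htri x a y hAxw hab hAxy).elim

theorem exists_good [Finite V] {k : ℕ} (hk : 3 ≤ k) (G : SimpleGraph V) (hG : G.Outerplanar)
    (htf : G.CliqueFree 3) (hdeg : ∀ v, (G.neighborSet v).ncard + 3 ≤ k) :
    ∃ a b : V → Fin k, Good G a b := by
  induction G using WellFoundedLT.induction with
  | _ G ih =>
    have hrec : ∀ (S : Set V) {u v : V}, G.Adj u v → u ∈ S →
        ∃ a b : V → Fin k, Good (isolate G S) a b := by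
      intro S u v huv hu
      have hlt := isolate_lt huv hu
      refine ih _ hlt ?_ (htf.anti hlt.le) fun v => ?_
      · obtain ⟨r, hr⟩ := hG
        exact ⟨r, fun a b c d h1 h2 => hr a b c d h1.1 h2.1⟩
      · have : ((isolate G S).neighborSet v).ncard ≤ (G.neighborSet v).ncard :=
          Set.ncard_le_ncard (fun w hw => hw.1) (Set.toFinite _)
        have := hdeg v
        omega
    by_cases hbot : ∀ u v, ¬ G.Adj u v
    · exact ⟨fun _ => ⟨0, by omega⟩, fun _ => ⟨1, by omega⟩, fun _ => by simp,
        fun u v h => absurd h (hbot u v), fun u v _ h => absurd h (hbot u v)⟩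
    push Not at hbot
    obtain ⟨u₀, v₀, h₀⟩ := hbot
    by_cases hmin : ∀ x u, G.Adj x u → ∃ v, G.Adj x v ∧ v ≠ u
    · have htwo : ∀ x t, G.Adj x t → 2 ≤ (G.neighborSet x).ncard := by
        intro x t hxt
        obtain ⟨s, hxs, hst⟩ := hmin x t hxt
        exact (Set.one_lt_ncard (Set.toFinite _)).2 ⟨t, hxt, s, hxs, hst.symm⟩
      by_cases h6 : 6 ≤ k
      · rcases exists_reducible hG htf hmin h₀ with
          ⟨u, x, y, z, w, hx, hy, hz, h1, h2, h3, h4, h5⟩ | ⟨u, x, y, v, hx, hy, huv, h1, h2⟩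
        · obtain ⟨a, b, hab⟩ := hrec {y, z} ((hy x).2 (.inl rfl)) (by simp)
          exact extend_path h6 hdeg hx hy hz h1 h2 h3 h4 h5 hab
        · obtain ⟨a, b, hab⟩ := hrec {x, y} ((hx u).2 (.inl rfl)) (by simp)
          exact extend_square h6 hdeg hx hy huv h1 h2 hab
      · obtain rfl : k = 5 := by
          have := hdeg u₀
          have := htwo u₀ v₀ h₀
          omega
        have hcyc : G.IsCycles := by
          rintro v ⟨w, hw⟩
          have := hdeg v
          have := htwo v w hw
          omega
        obtain ⟨n, g, hn, hg, hadj, hnbr⟩ := exists_cyclic_vertices hcyc htf h₀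
        obtain ⟨a, b, hab⟩ := hrec (Set.range g) (hadj 0) ⟨0, rfl⟩
        exact extend_cycle hn hg hnbr hab
    · push Not at hmin
      obtain ⟨x, u, hxu, hx⟩ := hmin
      have hk4 : 4 ≤ k := by
        have := hdeg x
        have := (Set.ncard_pos (Set.toFinite (G.neighborSet x))).2 ⟨u, hxu⟩
        omega
      obtain ⟨a, b, hab⟩ := hrec {x} hxu rfl
      exact extend_leaf hk4 hdeg (fun v => ⟨hx v, fun h => h ▸ hxu⟩) hab

theorem chiViS_one_le_of_good {k : ℕ} {G : SimpleGraph V} {a b : V → Fin k} (h : Good G a b) :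
    G.chiViS 1 ≤ k := by
  classical
  let c : V → Sym2 V → Fin k := fun v e => if h : v ∈ e then b (Sym2.Mem.other h) else b v
  have hc : ∀ v w, c v s(v, w) = b w := by
    intro v w
    have hv : v ∈ s(v, w) := Sym2.mem_mk_left v w
    have := Sym2.congr_right.1 (Sym2.other_spec hv)
    simp only [c, dif_pos hv, this]
  have hinc : ∀ {v e}, G.IsIncidence v e → ∃ w, G.Adj v w ∧ e = s(v, w) ∧ c v e = b w := by
    rintro v e ⟨he, hv⟩
    obtain ⟨w, rfl⟩ := Sym2.mem_iff_exists.1 hv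
    exact ⟨w, he, rfl, hc v w⟩
  refine Nat.sInf_le ⟨a, c, ⟨fun u v huv => (h.adj huv).1, ?_, ?_⟩, ?_⟩
  · intro u w f hf hu
    obtain ⟨x, hwx, rfl, hcx⟩ := hinc hf
    rw [hcx]
    rcases Sym2.mem_iff.1 hu with rfl | rfl
    · exact (h.adj hwx).2.1
    · exact h.self u
  · intro v e w f he hf hne hor
    obtain ⟨x, hvx, rfl, hcx⟩ := hinc he
    obtain ⟨y, hwy, rfl, hcy⟩ := hinc hf
    rw [hcx, hcy]
    rcases hor with rfl | hor | hor | hor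
    · exact h.nbr hvx hwy fun hxy => hne (by rw [hxy])
    · rcases Sym2.eq_iff.1 hor with ⟨rfl, rfl⟩ | ⟨rfl, rfl⟩
      · exact absurd rfl hne
      · exact (h.adj hwy).2.2.2
    · obtain rfl := Sym2.congr_right.1 hor
      exact (h.adj hwy).2.2.2
    · obtain rfl : v = y := Sym2.congr_right.1 (Sym2.eq_swap.trans hor)
      exact (h.adj hvx).2.2.2.symm
  · intro u
    refine (Set.ncard_le_ncard (t := {b u}) ?_ (Set.toFinite _)).trans (Set.ncard_singleton _).le
    rintro _ ⟨v, -, rfl⟩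
    rw [Sym2.eq_swap, hc]
    rfl

end ViColoring

/-- For every finite triangle-free outerplanar graph `G`, `χ_{vi,1}(G) ≤ Δ(G) + 3`. -/
theorem chiViS_one_le_of_triangleFree [Fintype V] (G : SimpleGraph V) (hG : G.Outerplanar)
    (htf : G.CliqueFree 3) :
    G.chiViS 1 ≤ G.maxDeg + 3 := by
  obtain ⟨a, b, hab⟩ := ViColoring.exists_good (k := G.maxDeg + 3) (by omega) G hG htf fun v =>
    Nat.add_le_add_right (Finset.le_sup (f := fun v => (G.neighborSet v).ncard)
      (Finset.mem_univ v)) 3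
  exact ViColoring.chiViS_one_le_of_good hab
end

section
/- If G is a finite 2-connected outerplanar graph with Δ(G) ≥ 4 and girth g(G) ≥ 6, then χ_{vi,1}(G) = Δ(G) + 2. -/
open SimpleGraph

variable {V : Type*}

/-- A pair `(c, d)` encoding a vi-simultaneous `(k, 1)`-coloring: `c` colors the vertices and
`d u` is the common color of the second incidences of `u`. -/
structure SimpleGraph.IsPairColoring_s14 (G : SimpleGraph V) {k : ℕ} (c d : V → Fin k) : Prop where
  c_ne : ∀ ⦃u v⦄, G.Adj u v → c u ≠ c v
  self_ne : ∀ u, c u ≠ d u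
  cross_ne : ∀ ⦃u v⦄, G.Adj u v → c u ≠ d v
  d_ne : ∀ ⦃u v⦄, G.Adj u v → d u ≠ d v
  d_ne_of_common : ∀ ⦃u v w⦄, G.Adj w u → G.Adj w v → u ≠ v → d u ≠ d v

/-- A graph without cycles of length 3, 4 or 5. -/
structure SimpleGraph.NoShortCycle (G : SimpleGraph V) : Prop where
  three : ∀ ⦃a b c⦄, G.Adj a b → G.Adj b c → ¬ G.Adj c a
  four : ∀ ⦃a b c d⦄, a ≠ c → b ≠ d → G.Adj a b → G.Adj b c → G.Adj c d → ¬ G.Adj d a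
  five : ∀ ⦃a b c d e⦄, a ≠ c → a ≠ d → b ≠ d → b ≠ e → c ≠ e →
    G.Adj a b → G.Adj b c → G.Adj c d → G.Adj d e → ¬ G.Adj e a

theorem SimpleGraph.NoShortCycle.mono {G H : SimpleGraph V} (hG : G.NoShortCycle) (h : H ≤ G) :
    H.NoShortCycle where
  three _ _ _ h₁ h₂ h₃ := hG.three (h h₁) (h h₂) (h h₃)
  four _ _ _ _ n₁ n₂ h₁ h₂ h₃ h₄ := hG.four n₁ n₂ (h h₁) (h h₂) (h h₃) (h h₄)
  five _ _ _ _ _ n₁ n₂ n₃ n₄ n₅ h₁ h₂ h₃ h₄ h₅ :=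
    hG.five n₁ n₂ n₃ n₄ n₅ (h h₁) (h h₂) (h h₃) (h h₄) (h h₅)

theorem SimpleGraph.noShortCycle_of_le_egirth {G : SimpleGraph V} (hg : 6 ≤ G.egirth) :
    G.NoShortCycle := by
  have key : ∀ {a : V} (w : G.Walk a a), w.IsCycle → 6 ≤ w.length := fun w hw => by
    exact_mod_cast SimpleGraph.le_egirth.1 hg _ w hw
  constructor
  · intro a b c h₁ h₂ h₃
    have := key (.cons h₁ (.cons h₂ (.cons h₃ .nil))) (by
      have := h₁.ne; have := h₂.ne; have := h₃.ne
      simp [Walk.cons_isCycle_iff]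
      grind)
    simp at this
  · intro a b c d n₁ n₂ h₁ h₂ h₃ h₄
    have := key (.cons h₁ (.cons h₂ (.cons h₃ (.cons h₄ .nil)))) (by
      have := h₁.ne; have := h₂.ne; have := h₃.ne; have := h₄.ne
      simp [Walk.cons_isCycle_iff]
      grind)
    simp at this
  · intro a b c d e n₁ n₂ n₃ n₄ n₅ h₁ h₂ h₃ h₄ h₅
    have := key (.cons h₁ (.cons h₂ (.cons h₃ (.cons h₄ (.cons h₅ .nil))))) (by
      have := h₁.ne; have := h₂.ne; have := h₃.ne; have := h₄.ne; have := h₅.ne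
      simp [Walk.cons_isCycle_iff]
      grind)
    simp at this

theorem Finset.exists_notMem_of_card_lt {k : ℕ} (s : Finset (Fin k)) (h : s.card < k) :
    ∃ a, a ∉ s := by
  by_contra! hs
  have : s = Finset.univ := Finset.eq_univ_of_forall hs
  simp [this] at h

/-- An outerplanar graph of girth at least 6 which has an edge but no leaf contains four
consecutive vertices of degree 2. -/
theorem SimpleGraph.NoShortCycle.exists_path [Finite V] [LinearOrder V] {H : SimpleGraph V}
    (hH : H.NoShortCycle)
    (hcross : ∀ a b c d : V, H.Adj a b → H.Adj c d → ¬(a < c ∧ c < b ∧ b < d))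
    (hleaf : ∀ v x, H.Adj v x → ∃ y, y ≠ x ∧ H.Adj v y) (hne : ∃ v x, H.Adj v x) :
    ∃ x v₁ v₂ v₃ v₄ y, x < v₁ ∧ v₁ < v₂ ∧ v₂ < v₃ ∧ v₃ < v₄ ∧ v₄ < y ∧
      (∀ z, H.Adj v₁ z ↔ z = x ∨ z = v₂) ∧ (∀ z, H.Adj v₂ z ↔ z = v₁ ∨ z = v₃) ∧
      (∀ z, H.Adj v₃ z ↔ z = v₂ ∨ z = v₄) ∧ (∀ z, H.Adj v₄ z ↔ z = v₃ ∨ z = y) := by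
  classical
  have hP : ∃ p : V × V, H.Adj p.1 p.2 ∧ p.1 < p.2 ∧ ∃ w z, p.1 < w ∧ w < p.2 ∧ H.Adj w z := by
    obtain ⟨v, ⟨x, hx⟩, hv⟩ := Set.exists_min_image {v | ∃ x, H.Adj v x} id (Set.toFinite _) hne
    obtain ⟨y, hyx, hy⟩ := hleaf v x hx
    have hvx : v < x := lt_of_le_of_ne (hv x ⟨v, hx.symm⟩) hx.ne
    have hvy : v < y := lt_of_le_of_ne (hv y ⟨v, hy.symm⟩) hy.ne
    rcases lt_or_gt_of_ne hyx with h | h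
    · exact ⟨(v, x), hx, hvx, y, v, hvy, h, hy.symm⟩
    · exact ⟨(v, y), hy, hvy, x, v, hvx, h, hx.symm⟩
  obtain ⟨⟨a, b⟩, ⟨hab, hlt, w, z, haw, hwb, hwz⟩, hmin⟩ := Set.exists_min_image
    {p : V × V | H.Adj p.1 p.2 ∧ p.1 < p.2 ∧ ∃ w z, p.1 < w ∧ w < p.2 ∧ H.Adj w z}
    (fun p => (Set.Ioo p.1 p.2).ncard) (Set.toFinite _) hP
  simp only at hab hlt haw hwb
  have hin : ∀ p q, H.Adj p q → a < p → p < b → a ≤ q ∧ q ≤ b := by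
    intro p q hpq h₁ h₂
    constructor
    · by_contra! h
      exact hcross q p a b hpq.symm hab ⟨h, h₁, h₂⟩
    · by_contra! h
      exact hcross a b p q hab hpq ⟨h₁, h₂, h⟩
  have hno : ∀ p q w z, H.Adj p q → a ≤ p → q ≤ b → (a < p ∨ q < b) → p < w → w < q →
      ¬ H.Adj w z := by
    intro p q w z hpq h₁ h₂ h₃ h₄ h₅ hwz
    have h := hmin (p, q) ⟨hpq, h₄.trans h₅, w, z, h₄, h₅, hwz⟩
    refine absurd h (not_le.2 (Set.ncard_lt_ncard ?_ (Set.toFinite _)))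
    refine ⟨Set.Ioo_subset_Ioo h₁ h₂, fun hsub => ?_⟩
    have hpq' := h₄.trans h₅
    rcases h₃ with h₃ | h₃
    · exact lt_irrefl p (hsub (show p ∈ Set.Ioo a b from ⟨h₃, hpq'.trans_le h₂⟩)).1
    · exact lt_irrefl q (hsub (show q ∈ Set.Ioo a b from ⟨h₁.trans_lt hpq', h₃⟩)).2
  have hnbr : ∀ w z, a < w → w < b → H.Adj w z → ∃ p q, a ≤ p ∧ p < w ∧ w < q ∧ q ≤ b ∧
      ∀ t, H.Adj w t ↔ t = p ∨ t = q := by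
    intro w z h₁ h₂ hwz
    obtain ⟨y, hyz, hwy⟩ := hleaf w z hwz
    have hup : ∀ s t, H.Adj w s → H.Adj w t → w < s → w < t → s = t := by
      intro s t hs ht h₃ h₄
      rcases lt_trichotomy s t with h | h | h
      · exact absurd hs.symm (hno w t s w ht h₁.le (hin w t ht h₁ h₂).2 (.inl h₁) h₃ h)
      · exact h
      · exact absurd ht.symm (hno w s t w hs h₁.le (hin w s hs h₁ h₂).2 (.inl h₁) h₄ h)
    have hdown : ∀ s t, H.Adj w s → H.Adj w t → s < w → t < w → s = t := by
      intro s t hs ht h₃ h₄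
      rcases lt_trichotomy s t with h | h | h
      · exact absurd ht.symm (hno s w t w hs.symm (hin w s hs h₁ h₂).1 h₂.le (.inr h₂) h h₄)
      · exact h
      · exact absurd hs.symm (hno t w s w ht.symm (hin w t ht h₁ h₂).1 h₂.le (.inr h₂) h h₃)
    have hz := hin w z hwz h₁ h₂
    have hy := hin w y hwy h₁ h₂
    rcases lt_or_gt_of_ne hwz.ne with h | h <;> rcases lt_or_gt_of_ne hwy.ne with h' | h'
    · exact absurd (hup _ _ hwy hwz h' h) hyz
    · refine ⟨y, z, hy.1, h', h, hz.2, fun t => ⟨fun ht => ?_, ?_⟩⟩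
      · rcases lt_or_gt_of_ne ht.ne with h'' | h''
        · exact .inr (hup _ _ ht hwz h'' h)
        · exact .inl (hdown _ _ ht hwy h'' h')
      · rintro (rfl | rfl) <;> assumption
    · refine ⟨z, y, hz.1, h, h', hy.2, fun t => ⟨fun ht => ?_, ?_⟩⟩
      · rcases lt_or_gt_of_ne ht.ne with h'' | h''
        · exact .inr (hup _ _ ht hwy h'' h')
        · exact .inl (hdown _ _ ht hwz h'' h)
      · rintro (rfl | rfl) <;> assumption
    · exact absurd (hdown _ _ hwy hwz h' h) hyz
  obtain ⟨v₁, ⟨hav₁, hv₁b, z₁, hz₁⟩, hv₁⟩ := Set.exists_min_image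
    {w | a < w ∧ w < b ∧ ∃ z, H.Adj w z} id (Set.toFinite _) ⟨w, haw, hwb, z, hwz⟩
  obtain ⟨x, v₂, hx, hxv₁, hv₁₂, hv₂, hN₁⟩ := hnbr v₁ z₁ hav₁ hv₁b hz₁
  obtain rfl : a = x := by
    by_contra hax
    have := hv₁ x ⟨lt_of_le_of_ne hx hax, hxv₁.trans hv₁b, v₁, ((hN₁ x).2 (.inl rfl)).symm⟩
    exact absurd this (not_le.2 hxv₁)
  have e₀ : H.Adj a v₁ := ((hN₁ a).2 (.inl rfl)).symm
  have e₁ : H.Adj v₁ v₂ := (hN₁ v₂).2 (.inr rfl)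
  have h₂b : v₂ < b := by
    refine lt_of_le_of_ne hv₂ ?_
    rintro rfl
    exact hH.three e₀ e₁ hab.symm
  obtain ⟨p₂, v₃, -, hp₂, hv₂₃, hv₃, hN₂⟩ := hnbr v₂ v₁ (hav₁.trans hv₁₂) h₂b e₁.symm
  obtain rfl : v₁ = p₂ := ((hN₂ v₁).1 e₁.symm).resolve_right (hv₁₂.trans hv₂₃).ne
  have e₂ : H.Adj v₂ v₃ := (hN₂ v₃).2 (.inr rfl)
  have h₃b : v₃ < b := by
    refine lt_of_le_of_ne hv₃ ?_
    rintro rfl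
    exact hH.four (hav₁.trans hv₁₂).ne (hv₁₂.trans hv₂₃).ne e₀ e₁ e₂ hab.symm
  obtain ⟨p₃, v₄, -, hp₃, hv₃₄, hv₄, hN₃⟩ :=
    hnbr v₃ v₂ (hav₁.trans (hv₁₂.trans hv₂₃)) h₃b e₂.symm
  obtain rfl : v₂ = p₃ := ((hN₃ v₂).1 e₂.symm).resolve_right (hv₂₃.trans hv₃₄).ne
  have e₃ : H.Adj v₃ v₄ := (hN₃ v₄).2 (.inr rfl)
  have h₄b : v₄ < b := by
    refine lt_of_le_of_ne hv₄ ?_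
    rintro rfl
    exact hH.five (hav₁.trans hv₁₂).ne (hav₁.trans (hv₁₂.trans hv₂₃)).ne (hv₁₂.trans hv₂₃).ne
      hv₁b.ne h₂b.ne e₀ e₁ e₂ e₃ hab.symm
  obtain ⟨p₄, y, -, hp₄, hv₄y, -, hN₄⟩ :=
    hnbr v₄ v₃ (hav₁.trans (hv₁₂.trans (hv₂₃.trans hv₃₄))) h₄b e₃.symm
  obtain rfl : v₃ = p₄ := ((hN₄ v₃).1 e₃.symm).resolve_right (hv₃₄.trans hv₄y).ne
  exact ⟨a, v₁, v₂, v₃, v₄, y, hav₁, hv₁₂, hv₂₃, hv₃₄, hv₄y, hN₁, hN₂, hN₃, hN₄⟩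

/-- A pair coloring extends over a pendant edge. -/
theorem SimpleGraph.IsPairColoring_s14.exists_of_leaf [Finite V] {H H' : SimpleGraph V} {k : ℕ}
    (hk : 5 ≤ k) {c d : V → Fin k} (h : H'.IsPairColoring_s14 c d) {v x : V}
    (hadj : ∀ p q, H'.Adj p q ↔ H.Adj p q ∧ s(p, q) ≠ s(v, x)) (hvx : H.Adj v x)
    (hleaf : ∀ y, H.Adj v y → y = x) (hdeg : (H.neighborSet x).ncard + 2 ≤ k) :
    ∃ c d : V → Fin k, H.IsPairColoring_s14 c d := by
  classical
  have := Fintype.ofFinite V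
  have hcard : (insert (c x) (insert (d x) ((H'.neighborFinset x).image d))).card < k := by
    have h₁ : (H'.neighborFinset x).card < (H.neighborSet x).ncard := by
      rw [← Set.ncard_coe_finset, coe_neighborFinset]
      refine Set.ncard_lt_ncard ⟨fun y hy => ((hadj _ _).1 hy).1, fun hsub => ?_⟩
        (Set.toFinite _)
      exact ((hadj x v).1 (hsub hvx.symm)).2 Sym2.eq_swap
    have h₂ := Finset.card_image_le (s := H'.neighborFinset x) (f := d)
    have h₃ := Finset.card_insert_le (d x) ((H'.neighborFinset x).image d)
    have h₄ := Finset.card_insert_le (c x) (insert (d x) ((H'.neighborFinset x).image d))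
    omega
  obtain ⟨dv, hdv⟩ := Finset.exists_notMem_of_card_lt _ hcard
  obtain ⟨cv, hcv⟩ := Finset.exists_notMem_of_card_lt {dv, d x, c x}
    (Finset.card_le_three.trans_lt (by omega))
  simp only [Finset.mem_insert, Finset.mem_image, mem_neighborFinset, not_or, not_exists,
    Finset.mem_singleton, not_and] at hdv hcv
  obtain ⟨hd₁, hd₂, hd₃⟩ := hdv
  obtain ⟨hc₁, hc₂, hc₃⟩ := hcv
  have hne := hvx.ne
  have hadj' : ∀ p q, p ≠ v → q ≠ v → H.Adj p q → H'.Adj p q := by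
    intro p q hp hq hpq
    refine (hadj p q).2 ⟨hpq, fun he => ?_⟩
    rcases Sym2.eq_iff.1 he with ⟨h, -⟩ | ⟨-, h⟩
    exacts [hp h, hq h]
  have hleaf' : ∀ y, H.Adj y v → y = x := fun y hy => hleaf y hy.symm
  have h1 := h.c_ne
  have h2 := h.self_ne
  have h3 := h.cross_ne
  have h4 := h.d_ne
  have h5 := h.d_ne_of_common
  refine ⟨Function.update c v cv, Function.update d v dv, ?_, ?_, ?_, ?_, ?_⟩
  all_goals
    intros
    simp only [Function.update_apply]
    grind [SimpleGraph.irrefl]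

/-- A pair coloring extends over the middle edge of a path of four vertices of degree 2. -/
theorem SimpleGraph.IsPairColoring_s14.exists_of_path [LinearOrder V] {H H' : SimpleGraph V} {k : ℕ}
    (hk : 6 ≤ k) {c d : V → Fin k} (h : H'.IsPairColoring_s14 c d) {x v₁ v₂ v₃ v₄ y : V}
    (hadj : ∀ p q, H'.Adj p q ↔ H.Adj p q ∧ s(p, q) ≠ s(v₂, v₃))
    (l₀ : x < v₁) (l₁ : v₁ < v₂) (l₂ : v₂ < v₃) (l₃ : v₃ < v₄) (l₄ : v₄ < y)
    (hN₁ : ∀ z, H.Adj v₁ z ↔ z = x ∨ z = v₂) (hN₂ : ∀ z, H.Adj v₂ z ↔ z = v₁ ∨ z = v₃)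
    (hN₃ : ∀ z, H.Adj v₃ z ↔ z = v₂ ∨ z = v₄) (hN₄ : ∀ z, H.Adj v₄ z ↔ z = v₃ ∨ z = y) :
    ∃ c d : V → Fin k, H.IsPairColoring_s14 c d := by
  obtain ⟨d₂, hd₂⟩ := Finset.exists_notMem_of_card_lt {d x, d v₁, d v₄}
    (Finset.card_le_three.trans_lt (by omega))
  obtain ⟨d₃, hd₃⟩ := Finset.exists_notMem_of_card_lt {d y, d v₁, d v₄, d₂}
    (Finset.card_le_four.trans_lt (by omega))
  obtain ⟨c₁, hc₁⟩ := Finset.exists_notMem_of_card_lt {c x, d x, d v₁, d₂}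
    (Finset.card_le_four.trans_lt (by omega))
  obtain ⟨c₂, hc₂⟩ := Finset.exists_notMem_of_card_lt {c₁, d v₁, d₂, d₃}
    (Finset.card_le_four.trans_lt (by omega))
  obtain ⟨c₃, hc₃⟩ := Finset.exists_notMem_of_card_lt {c₂, d₂, d₃, d v₄}
    (Finset.card_le_four.trans_lt (by omega))
  obtain ⟨c₄, hc₄⟩ := Finset.exists_notMem_of_card_lt {c₃, c y, d₃, d v₄, d y}
    (Finset.card_le_five.trans_lt (by omega))
  simp only [Finset.mem_insert, Finset.mem_singleton, not_or] at hd₂ hd₃ hc₁ hc₂ hc₃ hc₄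
  have hadj' : ∀ p q, H.Adj p q → H'.Adj p q ∨ (p = v₂ ∧ q = v₃) ∨ (p = v₃ ∧ q = v₂) := by
    intro p q hpq
    by_cases he : s(p, q) = s(v₂, v₃)
    · exact .inr (Sym2.eq_iff.1 he)
    · exact .inl ((hadj p q).2 ⟨hpq, he⟩)
  have hs : ∀ p q, H.Adj p q → H.Adj q p := fun _ _ h => h.symm
  have h1 := h.c_ne
  have h2 := h.self_ne
  have h3 := h.cross_ne
  have h4 := h.d_ne
  have h5 := h.d_ne_of_common
  have hne : x ≠ v₁ ∧ x ≠ v₂ ∧ x ≠ v₃ ∧ x ≠ v₄ ∧ v₁ ≠ v₂ ∧ v₁ ≠ v₃ ∧ v₁ ≠ v₄ ∧ v₂ ≠ v₃ ∧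
      v₂ ≠ v₄ ∧ v₃ ≠ v₄ ∧ y ≠ v₁ ∧ y ≠ v₂ ∧ y ≠ v₃ ∧ y ≠ v₄ := by
    refine ⟨?_, ?_, ?_, ?_, ?_, ?_, ?_, ?_, ?_, ?_, ?_, ?_, ?_, ?_⟩ <;> order
  have e₀ : H'.Adj v₁ x := (hadj' v₁ x ((hN₁ x).2 (.inl rfl))).resolve_right (by grind)
  have e₁ : H'.Adj v₁ v₂ := (hadj' v₁ v₂ ((hN₁ v₂).2 (.inr rfl))).resolve_right (by grind)
  have e₃ : H'.Adj v₄ v₃ := (hadj' v₄ v₃ ((hN₄ v₃).2 (.inl rfl))).resolve_right (by grind)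
  have e₄ : H'.Adj v₄ y := (hadj' v₄ y ((hN₄ y).2 (.inr rfl))).resolve_right (by grind)
  have e₀' := e₀.symm
  have e₄' := e₄.symm
  clear hadj l₀ l₁ l₂ l₃ l₄ hk h
  refine ⟨fun z => if z = v₁ then c₁ else if z = v₂ then c₂ else if z = v₃ then c₃ else
    if z = v₄ then c₄ else c z, fun z => if z = v₂ then d₂ else if z = v₃ then d₃ else d z,
    ?_, ?_, ?_, ?_, ?_⟩
  · intro u v huv
    have := hs _ _ huv
    grind
  · intro u
    grind
  · intro u v huv
    have := hs _ _ huv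
    grind
  · intro u v huv
    have := hs _ _ huv
    grind
  · intro u v w hu hv huv
    have key₂ : ∀ z, H.Adj w z → z = v₂ → w = v₁ ∨ w = v₃ := by
      rintro z hz rfl
      exact (hN₂ w).1 hz.symm
    have key₃ : ∀ z, H.Adj w z → z = v₃ → w = v₂ ∨ w = v₄ := by
      rintro z hz rfl
      exact (hN₃ w).1 hz.symm
    have := key₂ u hu
    have := key₂ v hv
    have := key₃ u hu
    have := key₃ v hv
    have := hadj' w u hu
    have := hadj' w v hv
    clear hs hadj' h1 h2 h3 key₂ key₃ hc₁ hc₂ hc₃ hc₄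
    grind

theorem SimpleGraph.NoShortCycle.exists_isPairColoring [Finite V] [LinearOrder V] {k : ℕ}
    (hk : 6 ≤ k) (H : SimpleGraph V) (hH : H.NoShortCycle)
    (hcross : ∀ a b c d : V, H.Adj a b → H.Adj c d → ¬(a < c ∧ c < b ∧ b < d))
    (hdeg : ∀ v, (H.neighborSet v).ncard + 2 ≤ k) :
    ∃ c d : V → Fin k, H.IsPairColoring_s14 c d := by
  induction H using WellFoundedLT.induction with
  | ind H ih =>
  by_cases hne : ∃ v x, H.Adj v x
  · have hdel : ∀ u v, H.Adj u v →
        ∃ c d : V → Fin k, (H.deleteEdges {s(u, v)}).IsPairColoring_s14 c d := by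
      intro u v huv
      have hle := H.deleteEdges_le {s(u, v)}
      refine ih _ (lt_of_le_of_ne hle fun he => ?_) (hH.mono hle)
        (fun a b c d hab hcd => hcross a b c d (hle hab) (hle hcd)) fun w => ?_
      · rw [← he, deleteEdges_adj] at huv
        exact huv.2 rfl
      · exact (Nat.add_le_add_right
          (Set.ncard_le_ncard (fun z hz => hle hz) (Set.toFinite _)) 2).trans (hdeg w)
    have hadj : ∀ e p q, (H.deleteEdges {e}).Adj p q ↔ H.Adj p q ∧ s(p, q) ≠ e := fun e p q => by
      simp [deleteEdges_adj]
    by_cases hleaf : ∀ v x, H.Adj v x → ∃ y, y ≠ x ∧ H.Adj v y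
    · obtain ⟨x, v₁, v₂, v₃, v₄, y, l₀, l₁, l₂, l₃, l₄, hN₁, hN₂, hN₃, hN₄⟩ :=
        hH.exists_path hcross hleaf hne
      obtain ⟨c, d, hcd⟩ := hdel v₂ v₃ ((hN₂ v₃).2 (.inr rfl))
      exact hcd.exists_of_path hk (hadj _) l₀ l₁ l₂ l₃ l₄ hN₁ hN₂ hN₃ hN₄
    · push Not at hleaf
      obtain ⟨v, x, hvx, hl⟩ := hleaf
      obtain ⟨c, d, hcd⟩ := hdel v x hvx
      exact hcd.exists_of_leaf (by omega) (hadj _) hvx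
        (fun y hy => by_contra fun hyx => hl y hyx hy) (hdeg x)
  · push Not at hne
    exact ⟨fun _ => ⟨0, by omega⟩, fun _ => ⟨1, by omega⟩,
      fun _ _ h => absurd h (hne _ _), fun _ => by simp, fun _ _ h => absurd h (hne _ _),
      fun _ _ h => absurd h (hne _ _), fun _ _ _ h => absurd h (hne _ _)⟩

/-- A pair coloring gives a vi-simultaneous `(k, 1)`-coloring. -/
theorem SimpleGraph.IsPairColoring_s14.exists_isViColoring {G : SimpleGraph V} {k : ℕ}
    {c d : V → Fin k} (h : G.IsPairColoring_s14 c d) :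
    ∃ cV cI, G.IsViColoring k cV cI ∧ ∀ u, (G.secondIncColors cI u).ncard ≤ 1 := by
  classical
  let cI : V → Sym2 V → Fin k := fun v e => if hv : v ∈ e then d (Sym2.Mem.other hv) else c v
  have hcI : ∀ v x, cI v s(v, x) = d x := fun v x => by
    have hv : v ∈ s(v, x) := Sym2.mem_mk_left v x
    simp only [cI, dif_pos hv]
    rw [Sym2.congr_right.1 (Sym2.other_spec hv)]
  have hinc : ∀ v e, G.IsIncidence v e → ∃ x, e = s(v, x) ∧ G.Adj v x := by
    rintro v e ⟨he, x, rfl⟩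
    exact ⟨x, rfl, he⟩
  refine ⟨c, cI, ⟨h.c_ne, ?_, ?_⟩, fun u => ?_⟩
  · intro u w f hw hu
    obtain ⟨x, rfl, hx⟩ := hinc w f hw
    rw [hcI]
    rcases Sym2.mem_iff.1 hu with rfl | rfl
    exacts [h.cross_ne hx, h.self_ne _]
  · intro v e w f hv hw hne hor
    obtain ⟨x, rfl, hx⟩ := hinc v e hv
    obtain ⟨y, rfl, hy⟩ := hinc w f hw
    rw [hcI, hcI]
    by_cases hvw : v = w
    · subst hvw
      exact h.d_ne_of_common hx hy fun hxy => hne (by rw [hxy])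
    · have h' : x = w ∨ y = v := by
        simp only [Sym2.eq_iff] at hor
        grind
      rcases h' with rfl | rfl
      exacts [h.d_ne hy, (h.d_ne hx).symm]
  · refine (Set.ncard_le_ncard (t := {d u}) ?_).trans (Set.ncard_singleton _).le
    rintro _ ⟨v, -, rfl⟩
    rw [Sym2.eq_swap, hcI]
    rfl

theorem SimpleGraph.IsViColoring.ncard_neighborSet_add_two_le [Finite V] {G : SimpleGraph V}
    {k : ℕ} {cV : V → Fin k} {cI : V → Sym2 V → Fin k} (h : G.IsViColoring k cV cI) {u : V}
    (hu : (G.neighborSet u).Nonempty) : (G.neighborSet u).ncard + 2 ≤ k := by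
  obtain ⟨w, hw⟩ := hu
  rw [mem_neighborSet] at hw
  have hu' : ∀ v, G.Adj u v → G.IsIncidence u s(u, v) := fun v hv => ⟨hv, Sym2.mem_mk_left _ _⟩
  have hw' : G.IsIncidence w s(u, w) := ⟨hw, Sym2.mem_mk_right _ _⟩
  set S := (fun v => cI u s(u, v)) '' G.neighborSet u
  have h₁ : S.ncard = (G.neighborSet u).ncard := by
    refine Set.InjOn.ncard_image fun v hv v' hv' he => ?_
    by_contra hne
    refine h.inc_ne (hu' v hv) (hu' v' hv') (fun hp => hne ?_) (.inl rfl) he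
    exact Sym2.congr_right.1 (Prod.ext_iff.1 hp).2
  have h₂ : cI w s(u, w) ∉ S := by
    rintro ⟨v, hv, he⟩
    exact h.inc_ne (hu' v hv) hw' (fun hp => hw.ne (Prod.ext_iff.1 hp).1)
      (.inr (.inr (.inr rfl))) he
  have h₃ : cV u ∉ insert (cI w s(u, w)) S := by
    rintro (he | ⟨v, hv, he⟩)
    · exact h.vertex_inc_ne hw' (Sym2.mem_mk_left _ _) he
    · exact h.vertex_inc_ne (hu' v hv) (Sym2.mem_mk_left _ _) he.symm
  have h₄ := Set.ncard_le_card (insert (cV u) (insert (cI w s(u, w)) S))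
  rwa [Set.ncard_insert_of_notMem h₃ (Set.toFinite _),
    Set.ncard_insert_of_notMem h₂ (Set.toFinite _), h₁, Nat.card_fin] at h₄

/-- If `G` is a finite 2-connected outerplanar graph with `Δ(G) ≥ 4` and girth `g(G) ≥ 6`,
then `χ_{vi,1}(G) = Δ(G) + 2`. -/
theorem chiViS_one_eq_of_twoConnected [Fintype V] (G : SimpleGraph V) (hG : G.Outerplanar)
    (h2 : G.TwoConnected) (hΔ : 4 ≤ G.maxDeg) (hg : 6 ≤ G.egirth) :
    G.chiViS 1 = G.maxDeg + 2 := by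
  have hle : ∀ v, (G.neighborSet v).ncard ≤ G.maxDeg := fun v =>
    Finset.le_sup (f := fun v => (G.neighborSet v).ncard) (Finset.mem_univ v)
  obtain ⟨r, hr⟩ := hG
  have hmem : ∃ cV cI, G.IsViColoring (G.maxDeg + 2) cV cI ∧
      ∀ u, (G.secondIncColors cI u).ncard ≤ 1 := by
    obtain ⟨c, d, hcd⟩ := (noShortCycle_of_le_egirth hg).exists_isPairColoring
      (k := G.maxDeg + 2) (by omega) G hr fun v => Nat.add_le_add_right (hle v) 2
    exact hcd.exists_isViColoring
  refine le_antisymm (Nat.sInf_le hmem) (le_csInf ⟨_, hmem⟩ ?_)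
  rintro k ⟨cV, cI, h, -⟩
  have : Nonempty V := h2.2.1.nonempty
  obtain ⟨u, -, hu⟩ := Finset.exists_mem_eq_sup Finset.univ Finset.univ_nonempty
    fun v => (G.neighborSet v).ncard
  change G.maxDeg = _ at hu
  rw [hu] at hΔ ⊢
  exact h.ncard_neighborSet_add_two_le (Set.nonempty_of_ncard_ne_zero (by omega))
end

section
/- Let G be a finite simple graph with maximum degree Δ and let c be a vi-simultaneous proper (Δ+2)-coloring of G. Then for every vertex v of degree d in G, the number of distinct colors that c uses on the second incidences of v satisfies |c(I_2(v))| ≤ Δ − d + 1. In particular, if v has degree Δ ≥ 1, then all second incidences of v receive the same color. -/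
open SimpleGraph

variable {V : Type*}

/-- The color of `v`, the colors of the incidences at `v` and the colors of the second incidences
of `v` are pairwise distinct, so together they number at most `k`. -/
theorem SimpleGraph.IsViColoring.ncard_secondIncColors_add_le {G : SimpleGraph V} {k : ℕ}
    {cV : V → Fin k} {cI : V → Sym2 V → Fin k} (hc : G.IsViColoring k cV cI) (v : V) :
    (G.secondIncColors cI v).ncard + (G.neighborSet v).ncard + 1 ≤ k := by
  have hfst {u : V} (h : G.Adj v u) : G.IsIncidence v s(v, u) := ⟨h, Sym2.mem_mk_left v u⟩
  have hsnd {u : V} (h : G.Adj v u) : G.IsIncidence u s(v, u) := ⟨h, Sym2.mem_mk_right v u⟩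
  set F : Set (Fin k) := (fun u => cI v s(v, u)) '' G.neighborSet v
  have hFcard : F.ncard = (G.neighborSet v).ncard := by
    refine Set.InjOn.ncard_image fun u hu w hw huw => ?_
    by_contra hne
    refine hc.inc_ne (hfst hu) (hfst hw) (fun h => hne ?_) (Or.inl rfl) huw
    exact Sym2.congr_right.mp (Prod.ext_iff.mp h).2
  have hdisj : Disjoint (G.secondIncColors cI v) F := by
    rw [Set.disjoint_left]
    rintro a ⟨w, hw, rfl⟩ ⟨u, hu, huw⟩
    exact hc.inc_ne (hfst hu) (hsnd hw) (fun h => hw.ne (Prod.ext_iff.mp h).1)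
      (Or.inr (Or.inr (Or.inr rfl))) huw
  have hv : cV v ∉ G.secondIncColors cI v ∪ F := by
    rintro (⟨w, hw, h⟩ | ⟨u, hu, h⟩)
    · exact hc.vertex_inc_ne (hsnd hw) (Sym2.mem_mk_left v w) h.symm
    · exact hc.vertex_inc_ne (hfst hu) (Sym2.mem_mk_left v u) h.symm
  have hle := Set.ncard_le_card (insert (cV v) (G.secondIncColors cI v ∪ F))
  rwa [Set.ncard_insert_of_notMem hv, Set.ncard_union_eq hdisj, hFcard, Nat.card_fin] at hle

/-- If `c` is a vi-simultaneous proper `(Δ + 2)`-coloring of a finite graph `G`, then for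
every vertex `v` of degree `d` the number of colors on `I_2(v)` is at most `Δ - d + 1`;
in particular, if `v` has degree `Δ ≥ 1`, all second incidences of `v` get the same color. -/
theorem secondIncColors_ncard_le [Fintype V] (G : SimpleGraph V)
    (cV : V → Fin (G.maxDeg + 2)) (cI : V → Sym2 V → Fin (G.maxDeg + 2))
    (hc : G.IsViColoring (G.maxDeg + 2) cV cI) :
    (∀ v, (G.secondIncColors cI v).ncard ≤ G.maxDeg - (G.neighborSet v).ncard + 1) ∧
    (∀ v, (G.neighborSet v).ncard = G.maxDeg → 1 ≤ G.maxDeg →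
      ∀ u w, G.Adj v u → G.Adj v w → cI u s(v, u) = cI w s(v, w)) := by
  have hle v : (G.secondIncColors cI v).ncard ≤ G.maxDeg - (G.neighborSet v).ncard + 1 := by
    have := hc.ncard_secondIncColors_add_le v
    omega
  refine ⟨hle, fun v hv _ u w hu hw => ?_⟩
  have h := hle v
  rw [hv, Nat.sub_self, zero_add] at h
  exact (Set.ncard_le_one).mp h _ ⟨u, hu, rfl⟩ _ ⟨w, hw, rfl⟩
end

section
/- For every natural number n ≥ 2, the complete graph K_n satisfies χ_vi(K_n) = n + 2. -/
open SimpleGraph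

variable {V : Type*}

/-- The incidence coloring of a complete graph obtained from a coloring `A` of the ordered pairs
of vertices, the incidence `(v, {v, w})` being identified with the pair `(v, w)`. -/
noncomputable def incColoringOfArcs {k : ℕ} (A : V → V → Fin k) (v : V) (e : Sym2 V) : Fin k :=
  open Classical in if h : v ∈ e then A v (Sym2.Mem.other h) else A v v

theorem incColoringOfArcs_mk {k : ℕ} (A : V → V → Fin k) (v w : V) :
    incColoringOfArcs A v s(v, w) = A v w := by
  have h : v ∈ s(v, w) := Sym2.mem_mk_left v w
  rw [incColoringOfArcs, dif_pos h, Sym2.congr_right.mp (Sym2.other_spec h)]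

theorem SimpleGraph.isIncidence_top_iff {v : V} {e : Sym2 V} :
    (⊤ : SimpleGraph V).IsIncidence v e ↔ ∃ w, v ≠ w ∧ e = s(v, w) := by
  constructor
  · rintro ⟨he, w, rfl⟩
    exact ⟨w, by simpa using he, rfl⟩
  · rintro ⟨w, hw, rfl⟩
    exact ⟨by simpa using hw, Sym2.mem_mk_left v w⟩

theorem isViColoring_incColoringOfArcs {k : ℕ} {cV : V → Fin k} {A : V → V → Fin k}
    (hV : Function.Injective cV)
    (htail : ∀ v w, v ≠ w → cV v ≠ A v w)
    (hhead : ∀ v w, v ≠ w → cV w ≠ A v w)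
    (hout : ∀ v w z, v ≠ w → v ≠ z → w ≠ z → A v w ≠ A v z)
    (hpath : ∀ v w z, v ≠ w → w ≠ z → A v w ≠ A w z) :
    (⊤ : SimpleGraph V).IsViColoring k cV (incColoringOfArcs A) where
  adj_ne u v huv := hV.ne huv
  vertex_inc_ne u w f hf hu := by
    obtain ⟨z, hz, rfl⟩ := isIncidence_top_iff.mp hf
    rw [incColoringOfArcs_mk]
    rcases Sym2.mem_iff.mp hu with rfl | rfl
    · exact htail _ _ hz
    · exact hhead _ _ hz
  inc_ne v e w f he hf hne hadj := by
    obtain ⟨x, hx, rfl⟩ := isIncidence_top_iff.mp he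
    obtain ⟨y, hy, rfl⟩ := isIncidence_top_iff.mp hf
    rw [incColoringOfArcs_mk, incColoringOfArcs_mk]
    by_cases hvw : v = w
    · subst hvw
      exact hout _ _ _ hx hy fun h => hne (by rw [h])
    · have hends : x = w ∨ y = v := by
        simp only [Sym2.eq_iff] at hadj
        grind
      rcases hends with rfl | rfl
      · exact hpath _ _ _ hx hy
      · exact (hpath _ _ _ hy hx).symm

/-- The involution of `ℕ` swapping `2 * i` and `2 * i + 1`. -/
def pairPartner (y : ℕ) : ℕ := if y % 2 = 0 then y + 1 else y - 1

/-- The color of the incidence `(x, {x, y})` in an optimal coloring of the complete graph on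
`{0, …, n - 1}` in which the vertex `i` has color `i`. -/
def completeArcColor (n x y : ℕ) : ℕ :=
  if pairPartner y = n then n
  else if x ≠ pairPartner y then pairPartner y
  else if x % 2 = 1 then n + 1
  else if n % 2 = 1 then n - 1
  else n

theorem completeArcColor_lt {n x y : ℕ} (hy : y < n) : completeArcColor n x y < n + 2 := by
  unfold completeArcColor pairPartner
  split_ifs <;> omega

theorem exists_isViColoring_top (n : ℕ) :
    ∃ cV cI, (⊤ : SimpleGraph (Fin n)).IsViColoring (n + 2) cV cI := by
  refine ⟨Fin.castAdd 2, _, isViColoring_incColoringOfArcs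
    (A := fun x y : Fin n => ⟨completeArcColor n x y, completeArcColor_lt y.isLt⟩)
    (Fin.castAdd_injective n 2) ?_ ?_ ?_ ?_⟩
  · rintro ⟨v, hv⟩ ⟨w, hw⟩
    simp only [ne_eq, Fin.ext_iff, Fin.val_castAdd, completeArcColor, pairPartner]
    split_ifs <;> omega
  · rintro ⟨v, hv⟩ ⟨w, hw⟩
    simp only [ne_eq, Fin.ext_iff, Fin.val_castAdd, completeArcColor, pairPartner]
    split_ifs <;> omega
  · rintro ⟨v, hv⟩ ⟨w, hw⟩ ⟨z, hz⟩
    simp only [ne_eq, Fin.ext_iff, completeArcColor, pairPartner]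
    split_ifs <;> omega
  · rintro ⟨v, hv⟩ ⟨w, hw⟩ ⟨z, hz⟩
    simp only [ne_eq, Fin.ext_iff, completeArcColor, pairPartner]
    split_ifs <;> omega

section LowerBound

variable {n k : ℕ} {cV : Fin n → Fin k} {cI : Fin n → Sym2 (Fin n) → Fin k}

/-- The color of the vertex `x` (at `w = x`) and of the incidences `(x, {x, w})`. -/
def colorsAt (cV : Fin n → Fin k) (cI : Fin n → Sym2 (Fin n) → Fin k) (x w : Fin n) : Fin k :=
  if w = x then cV x else cI x s(x, w)

theorem SimpleGraph.IsViColoring.colorsAt_injective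
    (h : (⊤ : SimpleGraph (Fin n)).IsViColoring k cV cI) (x : Fin n) :
    Function.Injective (colorsAt cV cI x) := by
  have hinc {w : Fin n} (hw : w ≠ x) : (⊤ : SimpleGraph (Fin n)).IsIncidence x s(x, w) :=
    isIncidence_top_iff.mpr ⟨w, hw.symm, rfl⟩
  intro w z hwz
  unfold colorsAt at hwz
  split_ifs at hwz with hw hz hz
  · rw [hw, hz]
  · exact absurd hwz (h.vertex_inc_ne (hinc hz) (Sym2.mem_mk_left x z))
  · exact absurd hwz.symm (h.vertex_inc_ne (hinc hw) (Sym2.mem_mk_left x w))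
  · by_contra hne
    refine h.inc_ne (hinc hw) (hinc hz) (fun he => hne ?_) (Or.inl rfl) hwz
    exact Sym2.congr_right.mp (Prod.ext_iff.mp he).2

theorem SimpleGraph.IsViColoring.exists_forall_colorsAt_ne
    (h : (⊤ : SimpleGraph (Fin n)).IsViColoring k cV cI) (hn : 2 ≤ n) (c : Fin k) :
    ∃ x, ∀ w, colorsAt cV cI x w ≠ c := by
  by_cases hc : ∃ x y, x ≠ y ∧ cI x s(x, y) = c
  · obtain ⟨x, y, hxy, rfl⟩ := hc
    have hx := isIncidence_top_iff.mpr ⟨y, hxy, rfl⟩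
    refine ⟨y, fun w => ?_⟩
    unfold colorsAt
    split_ifs with hw
    · exact h.vertex_inc_ne hx (Sym2.mem_mk_right x y)
    · refine (h.inc_ne hx (isIncidence_top_iff.mpr ⟨w, Ne.symm hw, rfl⟩)
        (fun he => hxy (Prod.ext_iff.mp he).1) (Or.inr (Or.inr (Or.inl rfl)))).symm
  · obtain ⟨x, hx⟩ : ∃ x, cV x ≠ c := by
      by_contra! hall
      have : (⟨0, by omega⟩ : Fin n) ≠ ⟨1, by omega⟩ := by simp
      exact h.adj_ne this ((hall _).trans (hall _).symm)
    refine ⟨x, fun w => ?_⟩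
    unfold colorsAt
    split_ifs with hw
    · exact hx
    · exact fun he => hc ⟨x, w, Ne.symm hw, he⟩

theorem SimpleGraph.IsViColoring.add_two_le
    (h : (⊤ : SimpleGraph (Fin n)).IsViColoring k cV cI) (hn : 2 ≤ n) : n + 2 ≤ k := by
  choose g hg using h.exists_forall_colorsAt_ne hn
  have hcard (x : Fin n) (s : Finset (Fin k)) (hs : ∀ c ∈ s, g c = x) : n + s.card ≤ k := by
    have hdisj : Disjoint (Finset.univ.image (colorsAt cV cI x)) s := by
      rw [Finset.disjoint_left]
      rintro c hc hcs
      obtain ⟨w, -, rfl⟩ := Finset.mem_image.mp hc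
      exact hg _ w (by rw [hs _ hcs])
    have := Finset.card_le_univ (Finset.univ.image (colorsAt cV cI x) ∪ s)
    rwa [Finset.card_union_of_disjoint hdisj,
      Finset.card_image_of_injective _ (h.colorsAt_injective x), Finset.card_univ,
      Fintype.card_fin, Fintype.card_fin] at this
  have hlt : n + 1 ≤ k := hcard (g (cV ⟨0, by omega⟩)) {cV ⟨0, by omega⟩} (by simp)
  obtain ⟨c, d, hcd, hgcd⟩ :=
    Fintype.exists_ne_map_eq_of_card_lt g (by simpa using hlt)
  simpa [Finset.card_pair hcd] using hcard (g c) {c, d} (by simp [hgcd])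

end LowerBound

/-- For every `n ≥ 2`, the complete graph `K_n` satisfies `χ_vi(K_n) = n + 2`. -/
theorem chiVi_completeGraph (n : ℕ) (hn : 2 ≤ n) :
    (⊤ : SimpleGraph (Fin n)).chiVi = n + 2 := by
  have hmem : n + 2 ∈ {k | ∃ cV cI, (⊤ : SimpleGraph (Fin n)).IsViColoring k cV cI} :=
    exists_isViColoring_top n
  refine le_antisymm (Nat.sInf_le hmem) (le_csInf ⟨_, hmem⟩ ?_)
  rintro k ⟨cV, cI, h⟩
  exact h.add_two_le hn
end
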